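/- Let A be a finite dimensional k-algebra of finite global dimension, and let P be a 2-term silting complex in K^b(proj A) such that the A-module H^0(P) has projective dimension at most 1. Then the endomorphism algebra B = End_{D^b(A)}(P) has global dimension at most 2·(gld A) + 2. -/

import Mathlib

/-!
Common setup: we model right `A`-modules as `ModuleCat Aᵐᵒᵖ`, the bounded derived
category `D^b(mod A)` as the full subcategory (given by the predicate `InDb`) of the
derived category of `Mod Aᵐᵒᵖ` consisting of cohomologically bounded complexes with
finitely generated cohomology, and `K^b(proj A)` via bounded complexes of finitely
generated projective modules (`IsPerfCplx`).
-/

namespace TwoTermSilting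

open CategoryTheory Limits Pretriangulated

universe w v u

noncomputable section

/-- The projective dimension of the module `M` is at most `n`. -/
def pdLE (R : Type u) [Ring R] : ℕ → ModuleCat.{v} R → Prop
  | 0, M => Projective M
  | (n+1), M => ∃ (P : ModuleCat.{v} R) (f : P ⟶ M),
      Projective P ∧ Epi f ∧ pdLE R n (kernel f)

/-- The (right) global dimension of `R` is at most `d`: every finitely generated
module has projective dimension at most `d`. -/
def gldLE (R : Type u) [Ring R] (d : ℕ) : Prop :=
  ∀ M : ModuleCat.{v} R, Module.Finite R M → pdLE R d M

section Star

variable {C : Type u} [Category.{v} C] [HasZeroObject C] [Preadditive C] [HasShift C ℤ]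
  [∀ n : ℤ, (shiftFunctor C n).Additive] [Pretriangulated C]

/-- `star S T` consists of the objects `Z` sitting in a distinguished triangle
`X ⟶ Z ⟶ Y ⟶ X⟦1⟧` with `X ∈ S` and `Y ∈ T`. -/
def star (S T : Set C) : Set C :=
  {Z | ∃ (X Y : C) (f : X ⟶ Z) (g : Z ⟶ Y) (h : Y ⟶ X⟦(1 : ℤ)⟧),
    X ∈ S ∧ Y ∈ T ∧ Triangle.mk f g h ∈ distTriang C}

/-- `starChain f n` is the iterated star product `f 0 * f 1 * ⋯ * f n`
(the star operation being associative). -/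
def starChain (f : ℕ → Set C) : ℕ → Set C
  | 0 => f 0
  | (n+1) => star (starChain f n) (f (n+1))

/-- The closure of a class of objects under the shift by `n`. -/
def shiftSet (S : Set C) (n : ℤ) : Set C :=
  {Y | ∃ X ∈ S, Nonempty (Y ≅ X⟦n⟧)}

/-- The additive closure of the object `X`: all direct summands of finite direct sums
of copies of `X`. -/
def addOf (X : C) : Set C :=
  {Y | ∃ (n : ℕ) (ι : Y ⟶ ⨁ (fun _ : Fin n => X)) (r : (⨁ (fun _ : Fin n => X)) ⟶ Y),
    ι ≫ r = 𝟙 Y}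

/-- A class of objects of a (pre)triangulated category is thick if it is closed under
isomorphisms, shifts, extensions and direct summands. -/
def IsThick (S : Set C) : Prop :=
  (∀ ⦃X Y : C⦄, (X ≅ Y) → X ∈ S → Y ∈ S) ∧
  (∀ (X : C) (n : ℤ), X ∈ S → (X⟦n⟧) ∈ S) ∧
  (∀ T : Triangle C, (T ∈ distTriang C) → T.obj₁ ∈ S → T.obj₃ ∈ S → T.obj₂ ∈ S) ∧
  (∀ (X Y : C) (ι : X ⟶ Y) (r : Y ⟶ X), ι ≫ r = 𝟙 X → Y ∈ S → X ∈ S)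

end Star

/-- The right `End Y`-module structure on `Y ⟶ X`, by precomposition. -/
instance endModule {C : Type u} [Category.{v} C] [Preadditive C] (Y X : C) :
    Module (End Y)ᵐᵒᵖ (Y ⟶ X) where
  smul b f := b.unop ≫ f
  one_smul f := Category.id_comp f
  mul_smul b₁ b₂ f := by
    show (b₁ * b₂).unop ≫ f = b₁.unop ≫ (b₂.unop ≫ f)
    have h : (b₁ * b₂).unop = b₁.unop ≫ b₂.unop := rfl
    rw [h, Category.assoc]
  smul_zero b := Limits.comp_zero
  smul_add b f g := Preadditive.comp_add _ _ _ _ _ _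
  add_smul b₁ b₂ f := Preadditive.add_comp _ _ _ _ _ _
  zero_smul f := Limits.zero_comp

section Main

variable (R : Type) [Ring R] [HasDerivedCategory.{w} (ModuleCat.{0} R)]

/-- A bounded complex of finitely generated projective modules
(an object of `K^b(proj R)`). -/
def IsPerfCplx (X : CochainComplex (ModuleCat.{0} R) ℤ) : Prop :=
  (∀ i, Projective (X.X i)) ∧ (∀ i, Module.Finite R (X.X i)) ∧
    ∃ a b : ℤ, ∀ i, (i < a ∨ b < i) → IsZero (X.X i)

/-- A complex of finitely generated projective modules concentrated in
degrees `-1` and `0`. -/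
def IsTwoTermCplx (X : CochainComplex (ModuleCat.{0} R) ℤ) : Prop :=
  (∀ i, Projective (X.X i)) ∧ (∀ i, Module.Finite R (X.X i)) ∧
    ∀ i, i ≠ -1 → i ≠ 0 → IsZero (X.X i)

/-- A two-term silting complex: a two-term complex of finitely generated projectives `P`
with `Hom_D(P, P[1]) = 0`, such that the smallest thick subcategory containing `P`
contains all of `K^b(proj R)`. -/
def IsTwoTermSilting (P : CochainComplex (ModuleCat.{0} R) ℤ) : Prop :=
  IsTwoTermCplx R P ∧
  (∀ f : DerivedCategory.Q.obj P ⟶ (DerivedCategory.Q.obj P)⟦(1 : ℤ)⟧, f = 0) ∧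
  (∀ S : Set (DerivedCategory (ModuleCat.{0} R)), IsThick S →
    DerivedCategory.Q.obj P ∈ S →
    ∀ X : CochainComplex (ModuleCat.{0} R) ℤ, IsPerfCplx R X → DerivedCategory.Q.obj X ∈ S)

/-- The objects of the derived category which belong to `D^b(mod R)`: cohomologically
bounded complexes with finitely generated cohomology. -/
def InDb (X : DerivedCategory (ModuleCat.{0} R)) : Prop :=
  (∃ a b : ℤ, ∀ i, (i < a ∨ b < i) →
    IsZero ((DerivedCategory.homologyFunctor (ModuleCat.{0} R) i).obj X)) ∧
  (∀ i : ℤ, Module.Finite R ((DerivedCategory.homologyFunctor (ModuleCat.{0} R) i).obj X))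

variable {R}

/-- The torsion class `T(P)` of finitely generated modules `X` with `Hom_D(P, X[1]) = 0`. -/
def TT (P : CochainComplex (ModuleCat.{0} R) ℤ) : Set (ModuleCat.{0} R) :=
  {X | Module.Finite R X ∧
    ∀ f : DerivedCategory.Q.obj P ⟶
      ((DerivedCategory.singleFunctor (ModuleCat.{0} R) 0).obj X)⟦(1 : ℤ)⟧, f = 0}

/-- The torsion-free class `F(P)` of finitely generated modules `Y` with `Hom_D(P, Y) = 0`. -/
def FF (P : CochainComplex (ModuleCat.{0} R) ℤ) : Set (ModuleCat.{0} R) :=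
  {Y | Module.Finite R Y ∧
    ∀ f : DerivedCategory.Q.obj P ⟶
      (DerivedCategory.singleFunctor (ModuleCat.{0} R) 0).obj Y, f = 0}

/-- The heart `C(P) = {X ∈ D^b(mod R) | Hom_D(P, X[i]) = 0 for all i ≠ 0}`. -/
def CP (P : CochainComplex (ModuleCat.{0} R) ℤ) : Set (DerivedCategory (ModuleCat.{0} R)) :=
  {X | InDb R X ∧ ∀ i : ℤ, i ≠ 0 → ∀ f : DerivedCategory.Q.obj P ⟶ X⟦i⟧, f = 0}

end Main

theorem hasProjectiveDimensionLE_of_pdLE {R : Type u} [Ring R] (n : ℕ) (M : ModuleCat.{v} R)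
    (h : pdLE R n M) : HasProjectiveDimensionLE M n := by
  induction n generalizing M with
  | zero => exact (projective_iff_hasProjectiveDimensionLE_zero (X := M)).1 h
  | succ n ih =>
    obtain ⟨P, f, hP, hf, hk⟩ := h
    have hS : (ShortComplex.mk _ _ (kernel.condition f)).ShortExact :=
      { exact := ShortComplex.exact_kernel f }
    exact hS.hasProjectiveDimensionLT_X₃ (n + 1) (ih _ hk)
      (by dsimp; infer_instance)

theorem pdLE_of_hasProjectiveDimensionLE {R : Type u} [Ring R] [Small.{v} R] (n : ℕ)
    (M : ModuleCat.{v} R) (h : HasProjectiveDimensionLE M n) : pdLE R n M := by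
  induction n generalizing M with
  | zero => exact (projective_iff_hasProjectiveDimensionLE_zero (X := M)).2 h
  | succ n ih =>
    refine ⟨Projective.over M, Projective.π M, inferInstance, inferInstance, ih _ ?_⟩
    have hS : (ShortComplex.mk _ _ (kernel.condition (Projective.π M))).ShortExact :=
      { exact := ShortComplex.exact_kernel _ }
    exact hS.hasProjectiveDimensionLT_X₁ (n + 1) (by dsimp; infer_instance) h

/-- Projective dimension of an unbundled module. -/
abbrev HasPD (R : Type u) [Ring R] (M : Type v) [AddCommGroup M] [Module R M] (n : ℕ) : Prop :=
  HasProjectiveDimensionLE (ModuleCat.of R M) n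

section

variable {R : Type u} [Ring R] {M N : Type v} [AddCommGroup M] [Module R M] [AddCommGroup N]
  [Module R N]

theorem HasPD.mono {m n : ℕ} (h : HasPD R M m) (hmn : m ≤ n) : HasPD R M n := by
  obtain ⟨k, rfl⟩ := Nat.exists_eq_add_of_le hmn
  have : HasProjectiveDimensionLT (ModuleCat.of R M) (m + 1) := h
  have h2 : HasProjectiveDimensionLT (ModuleCat.of R M) (m + 1 + k) := inferInstance
  rw [HasPD, HasProjectiveDimensionLE]
  convert h2 using 1
  omega

theorem HasPD.of_projective [Module.Projective R M] (n : ℕ) : HasPD R M n := by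
  have : HasPD R M 0 := by
    rw [HasPD, ← projective_iff_hasProjectiveDimensionLE_zero]
    infer_instance
  exact this.mono (Nat.zero_le n)

theorem HasPD.projective [Small.{v} R] (h : HasPD R M 0) : Module.Projective R M := by
  rw [HasPD, ← projective_iff_hasProjectiveDimensionLE_zero] at h
  exact (IsProjective.iff_projective M).2 h

theorem HasPD.of_equiv {n : ℕ} (h : HasPD R M n) (e : M ≃ₗ[R] N) : HasPD R N n :=
  have : HasProjectiveDimensionLT (ModuleCat.of R M) (n + 1) := h
  hasProjectiveDimensionLT_of_iso e.toModuleIso (n + 1)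

theorem HasPD.of_retract {n : ℕ} (h : HasPD R M n) (i : N →ₗ[R] M) (r : M →ₗ[R] N)
    (hir : r ∘ₗ i = LinearMap.id) : HasPD R N n :=
  have : HasProjectiveDimensionLT (ModuleCat.of R M) (n + 1) := h
  Retract.hasProjectiveDimensionLT (X := ModuleCat.of R N) (Y := ModuleCat.of R M)
    { i := ModuleCat.ofHom i, r := ModuleCat.ofHom r
      retract := by rw [← ModuleCat.ofHom_comp, hir]; rfl } (n + 1)

theorem HasPD.of_surjective {n : ℕ} (f : M →ₗ[R] N) (hf : Function.Surjective f)
    (hk : HasPD R (LinearMap.ker f) n) (hM : HasPD R M (n + 1)) : HasPD R N (n + 1) :=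
  (LinearMap.shortExact_shortComplexKer hf).hasProjectiveDimensionLT_X₃ (n + 1) hk hM

theorem HasPD.middle {n : ℕ} (f : M →ₗ[R] N) (hf : Function.Surjective f)
    (hk : HasPD R (LinearMap.ker f) n) (hN : HasPD R N n) : HasPD R M n :=
  (LinearMap.shortExact_shortComplexKer hf).hasProjectiveDimensionLT_X₂ (n + 1) hk hN

theorem HasPD.ker {n : ℕ} (f : M →ₗ[R] N) (hf : Function.Surjective f)
    (hM : HasPD R M n) (hN : HasPD R N (n + 1)) : HasPD R (LinearMap.ker f) n :=
  (LinearMap.shortExact_shortComplexKer hf).hasProjectiveDimensionLT_X₁ (n + 1) hM hN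

end

section

variable {R : Type w} [Ring R] {C : Type u} [Ring C] (π : R →+* C)

theorem exists_quotient_ker_equiv (hπ : Function.Surjective π) :
    ∃ e : (R ⧸ RingHom.ker π) ≃+ C, ∀ (r : R) x, e (r • x) = π r * e x := by
  let πb : R ⧸ RingHom.ker π →+ C := QuotientAddGroup.lift _ π.toAddMonoidHom (fun x hx ↦ hx)
  have hπb : ∀ r : R, πb (Submodule.Quotient.mk r) = π r := fun r ↦ rfl
  refine ⟨AddEquiv.ofBijective πb ⟨?_, fun y ↦ ?_⟩, fun r x ↦ ?_⟩
  · rw [injective_iff_map_eq_zero]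
    intro x hx
    obtain ⟨x, rfl⟩ := Submodule.Quotient.mk_surjective _ x
    exact (Submodule.Quotient.mk_eq_zero _).2 hx
  · obtain ⟨x, rfl⟩ := hπ y
    exact ⟨_, hπb x⟩
  · obtain ⟨x, rfl⟩ := Submodule.Quotient.mk_surjective _ x
    exact map_mul π r x

/-- If all finite powers of `R ⧸ ker π` have projective dimension at most `c` over `R`, then
restriction of scalars along the surjection `π` increases projective dimensions by at most `c`. -/
theorem HasPD.of_surjective_ringHom [IsNoetherianRing R] (hπ : Function.Surjective π) {c : ℕ}
    (hc : ∀ m : ℕ, HasPD R (Fin m → R ⧸ RingHom.ker π) c) (n : ℕ)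
    (N₀ : Type u) [AddCommGroup N₀] [Module C N₀] [Module.Finite C N₀] (h : HasPD C N₀ n)
    (N : Type w) [AddCommGroup N] [Module R N] (σ : N ≃+ N₀)
    (hσ : ∀ (r : R) (x : N), σ (r • x) = π r • σ x) : HasPD R N (n + c) := by
  have hCn : IsNoetherianRing C := isNoetherianRing_of_surjective R C π hπ
  obtain ⟨e, he⟩ := exists_quotient_ker_equiv π hπ
  induction n generalizing N₀ N with
  | zero =>
    obtain ⟨s, g₀, hg₀⟩ := Module.Finite.exists_fin' C N₀
    have hes : ∀ (r : R) y, e.symm (π r * y) = r • e.symm y := fun r y ↦ by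
      rw [e.symm_apply_eq, he, e.apply_symm_apply]
    have hσs : ∀ (r : R) y, σ.symm (π r • y) = r • σ.symm y := fun r y ↦ by
      rw [σ.symm_apply_eq, hσ, σ.apply_symm_apply]
    let g : (Fin s → R ⧸ RingHom.ker π) →ₗ[R] N :=
      { toFun := fun v ↦ σ.symm (g₀ fun i ↦ e (v i))
        map_add' := fun v v' ↦ by
          rw [← map_add, ← map_add]; congr; ext i; simp
        map_smul' := fun r v ↦ by
          rw [RingHom.id_apply, ← hσs, ← map_smul]; congr; ext i; simp [he] }
    have := h.projective
    obtain ⟨s₀, hs₀⟩ := Module.projective_lifting_property g₀ LinearMap.id hg₀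
    let s' : N →ₗ[R] (Fin s → R ⧸ RingHom.ker π) :=
      { toFun := fun x i ↦ e.symm (s₀ (σ x) i)
        map_add' := fun x y ↦ by ext i; simp
        map_smul' := fun r x ↦ by ext i; simp [hσ, hes] }
    rw [zero_add]
    refine (hc s).of_retract s' g ?_
    ext x
    have := LinearMap.congr_fun hs₀ (σ x)
    simp only [LinearMap.comp_apply, LinearMap.id_apply] at this
    simp [g, s', this]
  | succ n ih =>
    obtain ⟨s, g₀, hg₀⟩ := Module.Finite.exists_fin' C N₀
    have hσs : ∀ (r : R) y, σ.symm (π r • y) = r • σ.symm y := fun r y ↦ by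
      rw [σ.symm_apply_eq, hσ, σ.apply_symm_apply]
    let g : (Fin s → R ⧸ RingHom.ker π) →ₗ[R] N :=
      { toFun := fun v ↦ σ.symm (g₀ fun i ↦ e (v i))
        map_add' := fun v v' ↦ by
          rw [← map_add, ← map_add]; congr; ext i; simp
        map_smul' := fun r v ↦ by
          rw [RingHom.id_apply, ← hσs, ← map_smul]; congr; ext i; simp [he] }
    have hg : Function.Surjective g := by
      intro x
      obtain ⟨v, hv⟩ := hg₀ (σ x)
      exact ⟨fun i ↦ e.symm (v i), by simp [g, hv]⟩
    have hker : HasPD C (LinearMap.ker g₀) n := HasPD.ker g₀ hg₀ (HasPD.of_projective _) h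
    let τ : LinearMap.ker g ≃+ LinearMap.ker g₀ :=
      { toFun := fun v ↦ ⟨fun i ↦ e (v.1 i), by
          have := v.2
          rw [LinearMap.mem_ker] at this ⊢
          exact σ.symm.injective (this.trans σ.symm.map_zero.symm)⟩
        invFun := fun v ↦ ⟨fun i ↦ e.symm (v.1 i), by
          have := v.2
          rw [LinearMap.mem_ker] at this ⊢
          simp [g, this]⟩
        left_inv := fun v ↦ by ext; simp
        right_inv := fun v ↦ by ext; simp
        map_add' := fun v v' ↦ by ext; simp }
    have := ih (LinearMap.ker g₀) hker (LinearMap.ker g) τ (fun r x ↦ by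
      ext i; simp [τ, he])
    have h2 := HasPD.of_surjective g hg this ((hc s).mono (by omega))
    rwa [Nat.add_right_comm] at h2

theorem exists_small_model (hπ : Function.Surjective π)
    (N : Type w) [AddCommGroup N] [Module R N] [Module.Finite R N]
    (hN : ∀ (r : R) (x : N), π r = 0 → r • x = 0) :
    ∃ (N₀ : Type u) (_ : AddCommGroup N₀) (_ : Module C N₀) (_ : Module.Finite C N₀)
      (σ : N ≃+ N₀), ∀ (r : R) (x : N), σ (r • x) = π r • σ x := by
  let l := Function.surjInv hπ
  have hl : ∀ (r : R) (x : N), l (π r) • x = r • x := by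
    intro r x
    rw [← sub_eq_zero, ← sub_smul]
    exact hN _ _ (by rw [map_sub, sub_eq_zero]; exact Function.surjInv_eq hπ _)
  have hl' : ∀ (c : C) (r : R) (x : N), π r = c → l c • x = r • x := by
    rintro _ r x rfl; exact hl r x
  have hlc : ∀ c, π (l c) = c := Function.surjInv_eq hπ
  obtain ⟨s, g, hg⟩ := Module.Finite.exists_fin' R N
  have hsmall : Small.{u} N := by
    refine small_of_surjective (f := fun v : Fin s → C ↦ g fun i ↦ l (v i)) ?_
    intro x
    obtain ⟨v, rfl⟩ := hg x
    refine ⟨fun i ↦ π (v i), ?_⟩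
    dsimp only
    rw [LinearMap.pi_apply_eq_sum_univ g v, LinearMap.pi_apply_eq_sum_univ g]
    exact Finset.sum_congr rfl fun i _ ↦ hl _ _
  let σ : N ≃+ Shrink.{u} N := (Shrink.addEquiv (α := N)).symm
  let _ : Module C (Shrink.{u} N) :=
    { smul := fun c x ↦ σ (l c • σ.symm x)
      one_smul := fun x ↦ by
        show σ (l 1 • σ.symm x) = x
        rw [hl' 1 1 _ (map_one π), one_smul, σ.apply_symm_apply]
      mul_smul := fun a b x ↦ by
        show σ (l (a * b) • σ.symm x) = σ (l a • σ.symm (σ (l b • σ.symm x)))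
        rw [σ.symm_apply_apply, smul_smul,
          hl' (a * b) (l a * l b) _ (by rw [map_mul, hlc, hlc])]
      smul_zero := fun a ↦ by
        show σ (l a • σ.symm 0) = 0
        simp
      smul_add := fun a x y ↦ by
        show σ (l a • σ.symm (x + y)) = σ (l a • σ.symm x) + σ (l a • σ.symm y)
        simp
      add_smul := fun a b x ↦ by
        show σ (l (a + b) • σ.symm x) = σ (l a • σ.symm x) + σ (l b • σ.symm x)
        rw [hl' (a + b) (l a + l b) _ (by rw [map_add, hlc, hlc]), add_smul, map_add]
      zero_smul := fun x ↦ by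
        show σ (l 0 • σ.symm x) = 0
        rw [hl' 0 0 _ (map_zero π), zero_smul, map_zero] }
  have hσ : ∀ (r : R) (x : N), σ (r • x) = π r • σ x := fun r x ↦ by
    show _ = σ (l (π r) • σ.symm (σ x))
    rw [hl, σ.symm_apply_apply]
  refine ⟨Shrink.{u} N, inferInstance, inferInstance, ?_, σ, hσ⟩
  let f : N →ₛₗ[π] Shrink.{u} N := { σ.toAddMonoidHom with map_smul' := hσ }
  have : RingHomSurjective π := ⟨hπ⟩
  exact Module.Finite.of_surjective f σ.surjective

/-- The global dimension of a ring with a triangular decomposition. -/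
theorem hasPD_of_triangular [IsNoetherianRing R] (hπ : Function.Surjective π)
    {E : Type u} [Ring E] (ε : R →+* E) (hε : Function.Surjective ε) (e : R) (hπe : π e = 1)
    (he₁ : ∀ y, π y = 0 → y * e = 0) (he₂ : ∀ x, ε x = 0 → e * x = x) {c d : ℕ}
    (hC : ∀ (N : Type u) [AddCommGroup N] [Module C N] [Module.Finite C N], HasPD C N c)
    (hE : ∀ (N : Type u) [AddCommGroup N] [Module E N] [Module.Finite E N], HasPD E N d)
    (M : Type w) [AddCommGroup M] [Module R M] [Module.Finite R M] :
    HasPD R M (d + (c + 1)) := by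
  have hJI : ∀ y x, π y = 0 → ε x = 0 → y * x = 0 := fun y x hy hx ↦ by
    rw [← he₂ x hx, ← mul_assoc, he₁ y hy, zero_mul]
  have hRJ : Module.Projective R (R ⧸ RingHom.ker π) := by
    let f : R ⧸ RingHom.ker π →ₗ[R] R :=
      (RingHom.ker π).liftQ (LinearMap.toSpanSingleton R R e) (fun y hy ↦ he₁ y hy)
    refine Module.Projective.of_split f (RingHom.ker π).mkQ ?_
    refine LinearMap.ext fun x ↦ ?_
    obtain ⟨x, rfl⟩ := Submodule.Quotient.mk_surjective _ x
    refine (Submodule.Quotient.eq _).2 ?_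
    show π (x * e - x) = 0
    rw [map_sub, map_mul, hπe, mul_one, sub_self]
  have hCR : ∀ (N : Type w) [AddCommGroup N] [Module R N] [Module.Finite R N],
      (∀ (r : R) (x : N), π r = 0 → r • x = 0) → HasPD R N c := by
    intro N _ _ _ hN
    obtain ⟨N₀, _, _, _, σ, hσ⟩ := exists_small_model π hπ N hN
    have := HasPD.of_surjective_ringHom π hπ (c := 0) (fun m ↦
      have : Module.Projective R (Fin m → R ⧸ RingHom.ker π) :=
        Module.Projective.of_equiv (DFinsupp.linearEquivFunOnFintype (R := R)
          (M := fun _ : Fin m ↦ R ⧸ RingHom.ker π))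
      HasPD.of_projective 0) c N₀
      (hC N₀) N σ hσ
    simpa using this
  have hRI : ∀ m : ℕ, HasPD R (Fin m → R ⧸ RingHom.ker ε) (c + 1) := by
    intro m
    let f : (Fin m → R) →ₗ[R] (Fin m → R ⧸ RingHom.ker ε) :=
      LinearMap.pi fun i ↦ (RingHom.ker ε).mkQ ∘ₗ LinearMap.proj i
    have hf : Function.Surjective f := by
      intro v
      choose u hu using fun i ↦ Submodule.Quotient.mk_surjective _ (v i)
      exact ⟨u, funext hu⟩
    refine HasPD.of_surjective f hf (hCR _ ?_) (HasPD.of_projective _)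
    intro r x hr
    ext i
    refine hJI r _ hr ?_
    have := congrFun (LinearMap.mem_ker.1 x.2) i
    exact (Submodule.Quotient.mk_eq_zero _).1 this
  let IM : Submodule R M := Submodule.span R {z | ∃ (r : R) (x : M), ε r = 0 ∧ z = r • x}
  have h₁ : HasPD R IM c := by
    refine hCR _ ?_
    rintro r ⟨x, hx⟩ hr
    ext
    simp only [Submodule.coe_smul_of_tower, Submodule.coe_zero]
    induction hx using Submodule.span_induction generalizing r with
    | mem x h =>
      obtain ⟨s, x, hs, rfl⟩ := h
      rw [smul_smul, hJI r s hr hs, zero_smul]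
    | zero => simp
    | add x y _ _ hx hy => rw [smul_add, hx r hr, hy r hr, add_zero]
    | smul a x _ hx =>
      rw [smul_smul]
      exact hx _ (by rw [map_mul, hr, zero_mul])
  have h₂ : HasPD R (M ⧸ IM) (d + (c + 1)) := by
    obtain ⟨N₀, _, _, _, σ, hσ⟩ := exists_small_model ε hε (M ⧸ IM) (by
      intro r x hr
      obtain ⟨x, rfl⟩ := Submodule.Quotient.mk_surjective _ x
      rw [← Submodule.Quotient.mk_smul]
      exact (Submodule.Quotient.mk_eq_zero _).2 (Submodule.subset_span ⟨r, x, hr, rfl⟩))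
    exact HasPD.of_surjective_ringHom ε hε hRI d N₀ (hE N₀) _ σ hσ
  refine HasPD.middle IM.mkQ IM.mkQ_surjective ?_ h₂
  exact (h₁.mono (by omega)).of_equiv (LinearEquiv.ofEq _ _ IM.ker_mkQ.symm)

end

section FiniteDimensional

variable (k : Type) {S : Type} [Field k] [Ring S] [Algebra k S]

/-- Multiplication by a scalar of the base field, as an endomorphism of an `S`-module. -/
def scalarEnd (M : Type) [AddCommGroup M] [Module S M] (c : k) : M →ₗ[S] M where
  toFun m := algebraMap k S c • m
  map_add' x y := smul_add (algebraMap k S c) x y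
  map_smul' s m := by
    rw [smul_smul, Algebra.commutes, ← smul_smul, RingHom.id_apply]

@[simp]
theorem scalarEnd_apply (M : Type) [AddCommGroup M] [Module S M] (c : k) (m : M) :
    scalarEnd k (S := S) M c m = algebraMap k S c • m := rfl

theorem finite_linearMap [FiniteDimensional k S] (M N : Type) [AddCommGroup M] [Module S M]
    [AddCommGroup N] [Module S N] [Module k M] [Module k N] [IsScalarTower k S M]
    [IsScalarTower k S N] [SMulCommClass S k N] [Module.Finite S M] [Module.Finite S N] :
    Module.Finite k (M →ₗ[S] N) := by
  have : Module.Finite k M := Module.Finite.trans S M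
  have : Module.Finite k N := Module.Finite.trans S N
  exact Module.Finite.of_injective (LinearMap.restrictScalarsₗ k S M N k)
    (LinearMap.restrictScalars_injective k)

theorem exists_span_hom [FiniteDimensional k S] (M N : Type) [AddCommGroup M] [Module S M]
    [AddCommGroup N] [Module S N] [Module.Finite S M] [Module.Finite S N] :
    ∃ (m : ℕ) (x : Fin m → (M →ₗ[S] N)), ∀ u : M →ₗ[S] N, ∃ c : Fin m → k,
      u = ∑ i, x i ∘ₗ scalarEnd k M (c i) := by
  let : Module k M := Module.compHom M (algebraMap k S)
  let : Module k N := Module.compHom N (algebraMap k S)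
  have : IsScalarTower k S M := IsScalarTower.of_algebraMap_smul fun _ _ => rfl
  have : IsScalarTower k S N := IsScalarTower.of_algebraMap_smul fun _ _ => rfl
  have : SMulCommClass S k N := ⟨fun s c n => by
    change s • algebraMap k S c • n = algebraMap k S c • s • n
    rw [smul_smul, smul_smul, Algebra.commutes]⟩
  have := finite_linearMap k (S := S) M N
  obtain ⟨m, x, hx⟩ := Module.Finite.exists_fin (R := k) (M := M →ₗ[S] N)
  refine ⟨m, x, fun u => ?_⟩
  have hu : u ∈ Submodule.span k (Set.range x) := hx ▸ Submodule.mem_top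
  obtain ⟨c, hc⟩ := (Submodule.mem_span_range_iff_exists_fun k).1 hu
  refine ⟨c, ?_⟩
  rw [← hc]
  ext p
  simp only [LinearMap.sum_apply, LinearMap.comp_apply, scalarEnd_apply, map_smul]
  rfl

theorem exists_approx [FiniteDimensional k S] (M N : Type) [AddCommGroup M] [Module S M]
    [AddCommGroup N] [Module S N] [Module.Finite S M] [Module.Finite S N] :
    ∃ (m : ℕ) (a : (Fin m → M) →ₗ[S] N), ∀ u : M →ₗ[S] N, ∃ v : M →ₗ[S] (Fin m → M),
      a ∘ₗ v = u := by
  obtain ⟨m, x, hx⟩ := exists_span_hom k (S := S) M N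
  refine ⟨m, ∑ i, x i ∘ₗ LinearMap.proj i, fun u => ?_⟩
  obtain ⟨c, rfl⟩ := hx u
  refine ⟨LinearMap.pi fun i => scalarEnd k M (c i), ?_⟩
  ext p
  simp

end FiniteDimensional

section HomFunctor

variable {S T X Y Z : Type} [Ring S] [AddCommGroup T] [Module S T] [AddCommGroup X] [Module S X]
  [AddCommGroup Y] [Module S Y] [AddCommGroup Z] [Module S Z]

/-- The right module structure on `T →ₗ[S] X` over the endomorphism ring of `T`. -/
instance homModule : Module (Module.End S T)ᵐᵒᵖ (T →ₗ[S] X) where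
  smul c f := f ∘ₗ c.unop
  one_smul := LinearMap.comp_id
  mul_smul _ _ _ := LinearMap.comp_assoc _ _ _
  smul_zero _ := LinearMap.zero_comp _
  smul_add _ _ _ := LinearMap.add_comp _ _ _
  add_smul _ _ _ := LinearMap.comp_add _ _ _
  zero_smul _ := LinearMap.comp_zero _

theorem op_smul_def (c : (Module.End S T)ᵐᵒᵖ) (f : T →ₗ[S] X) : c • f = f ∘ₗ c.unop := rfl

variable (T) in
/-- Composition with a linear map, as a map of modules over the opposite endomorphism ring. -/
def homMap (φ : X →ₗ[S] Y) : (T →ₗ[S] X) →ₗ[(Module.End S T)ᵐᵒᵖ] (T →ₗ[S] Y) where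
  toFun f := φ ∘ₗ f
  map_add' _ _ := LinearMap.comp_add _ _ _
  map_smul' c f := by ext; rfl

@[simp]
theorem homMap_apply (φ : X →ₗ[S] Y) (f : T →ₗ[S] X) : homMap T φ f = φ ∘ₗ f := rfl

theorem homMap_comp (φ : X →ₗ[S] Y) (ψ : Y →ₗ[S] Z) :
    homMap T (ψ ∘ₗ φ) = homMap T ψ ∘ₗ homMap T φ := rfl

theorem homMap_id : homMap T (LinearMap.id : X →ₗ[S] X) = LinearMap.id := rfl

theorem isNoetherianRing_endOp (k : Type) [Field k] [Algebra k S] [FiniteDimensional k S]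
    [Module.Finite S T] :
    IsNoetherianRing (Module.End S T)ᵐᵒᵖ := by
  let : Module k T := Module.compHom T (algebraMap k S)
  have : IsScalarTower k S T := IsScalarTower.of_algebraMap_smul fun _ _ => rfl
  have : SMulCommClass S k T := ⟨fun s c n => by
    change s • algebraMap k S c • n = algebraMap k S c • s • n
    rw [smul_smul, smul_smul, Algebra.commutes]⟩
  have := finite_linearMap k (S := S) T T
  have : Module.Finite k (Module.End S T)ᵐᵒᵖ := inferInstance
  exact IsNoetherianRing.of_finite k _

end HomFunctor

section LinearAlgebra

variable {S : Type u} {X Y Z W : Type v} [Ring S] [AddCommGroup X] [Module S X]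
  [AddCommGroup Y] [Module S Y] [AddCommGroup Z] [Module S Z] [AddCommGroup W] [Module S W]

theorem exists_comp_eq_of_ker_le (ρ : X →ₗ[S] Y) (hρ : Function.Surjective ρ) (s : X →ₗ[S] Z)
    (h : ∀ x, ρ x = 0 → s x = 0) : ∃ σ : Y →ₗ[S] Z, σ ∘ₗ ρ = s := by
  refine ⟨(LinearMap.ker ρ).liftQ s h ∘ₗ (ρ.quotKerEquivOfSurjective hρ).symm.toLinearMap, ?_⟩
  ext x
  have : (ρ.quotKerEquivOfSurjective hρ).symm (ρ x) = (LinearMap.ker ρ).mkQ x := by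
    rw [LinearEquiv.symm_apply_eq]; rfl
  exact (congrArg ((LinearMap.ker ρ).liftQ s h) this).trans (Submodule.liftQ_apply _ _ _)

theorem HasPD.pi {n : ℕ} (h : HasPD S X n) (m : ℕ) : HasPD S (Fin m → X) n := by
  induction m with
  | zero => exact HasPD.of_projective n
  | succ m ih =>
    let f : (Fin (m + 1) → X) →ₗ[S] X := LinearMap.proj 0
    have hf : Function.Surjective f := fun x => ⟨fun _ => x, rfl⟩
    refine HasPD.middle f hf (ih.of_equiv ?_) h
    refine LinearEquiv.ofBijective
      (LinearMap.codRestrict (LinearMap.ker f)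
        (LinearMap.pi (Fin.cases 0 fun i => LinearMap.proj i) : (Fin m → X) →ₗ[S] _) ?_) ⟨?_, ?_⟩
    · intro c; simp [f]
    · intro x y hxy
      ext i
      exact congr_fun (congr_arg Subtype.val hxy) i.succ
    · rintro ⟨x, hx⟩
      refine ⟨fun i => x i.succ, ?_⟩
      ext i
      refine Fin.cases ?_ (fun i => ?_) i
      · simpa [f] using Eq.symm hx
      · simp

theorem projective_pi [Small.{v} S] [Module.Projective S X] (m : ℕ) :
    Module.Projective S (Fin m → X) :=
  ((HasPD.of_projective 0).pi m).projective

end LinearAlgebra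

section HomFunctor

variable {S T X Y : Type} [Ring S] [AddCommGroup T] [Module S T] [AddCommGroup X] [Module S X]
  [AddCommGroup Y] [Module S Y]

variable (S T) in
/-- `Hom(T, T^n)` is free over the opposite endomorphism ring. -/
def homPiEquiv (n : ℕ) :
    (T →ₗ[S] (Fin n → T)) ≃ₗ[(Module.End S T)ᵐᵒᵖ] (Fin n → (Module.End S T)ᵐᵒᵖ) where
  toFun f i := MulOpposite.op (LinearMap.proj i ∘ₗ f)
  map_add' _ _ := rfl
  map_smul' _ _ := rfl
  invFun g := LinearMap.pi fun i => (g i).unop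
  left_inv _ := rfl
  right_inv _ := rfl

theorem projective_hom_pi (n : ℕ) :
    Module.Projective (Module.End S T)ᵐᵒᵖ (T →ₗ[S] (Fin n → T)) :=
  Module.Projective.of_equiv (homPiEquiv S T n).symm

theorem finite_hom_pi (n : ℕ) :
    Module.Finite (Module.End S T)ᵐᵒᵖ (T →ₗ[S] (Fin n → T)) :=
  Module.Finite.equiv (homPiEquiv S T n).symm

theorem exists_eq_homMap {n : ℕ}
    (α : (T →ₗ[S] (Fin n → T)) →ₗ[(Module.End S T)ᵐᵒᵖ] (T →ₗ[S] X)) :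
    ∃ φ : (Fin n → T) →ₗ[S] X, α = homMap T φ := by
  refine ⟨∑ i, α (LinearMap.single S (fun _ => T) i) ∘ₗ LinearMap.proj i, ?_⟩
  ext1 f
  have hf : f = ∑ i, MulOpposite.op (LinearMap.proj i ∘ₗ f : Module.End S T) •
      LinearMap.single S (fun _ => T) i := by
    ext x i
    simp [op_smul_def, Finset.sum_apply, Pi.single_apply]
  conv_lhs => rw [hf, map_sum]
  simp only [map_smul]
  ext x
  simp [op_smul_def]

theorem exists_hom_presentation [IsNoetherianRing (Module.End S T)ᵐᵒᵖ] (N : Type)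
    [AddCommGroup N] [Module (Module.End S T)ᵐᵒᵖ N] [Module.Finite (Module.End S T)ᵐᵒᵖ N] :
    ∃ (n m : ℕ) (φ : (Fin m → T) →ₗ[S] (Fin n → T))
      (q : (T →ₗ[S] (Fin n → T)) →ₗ[(Module.End S T)ᵐᵒᵖ] N), Function.Surjective q ∧
      LinearMap.ker q = LinearMap.range (homMap T φ) := by
  obtain ⟨n, q₀, hq₀⟩ := Module.Finite.exists_fin' (Module.End S T)ᵐᵒᵖ N
  let q := q₀ ∘ₗ (homPiEquiv S T n).toLinearMap
  have hq : Function.Surjective q := hq₀.comp (homPiEquiv S T n).surjective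
  have := finite_hom_pi (S := S) (T := T) n
  have : IsNoetherian (Module.End S T)ᵐᵒᵖ (T →ₗ[S] (Fin n → T)) :=
    isNoetherian_of_isNoetherianRing_of_finite _ _
  obtain ⟨m, r₀, hr₀⟩ := Module.Finite.exists_fin' (Module.End S T)ᵐᵒᵖ (LinearMap.ker q)
  obtain ⟨φ, hφ⟩ := exists_eq_homMap
    ((LinearMap.ker q).subtype ∘ₗ r₀ ∘ₗ (homPiEquiv S T m).toLinearMap)
  refine ⟨n, m, φ, q, hq, ?_⟩
  rw [← hφ, LinearMap.range_comp, LinearMap.range_eq_top.2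
    (by exact hr₀.comp (homPiEquiv S T m).surjective)]
  simp

variable (T) in
/-- `Hom(T, -)` preserves kernels. -/
def homKerEquiv (φ : X →ₗ[S] Y) :
    (T →ₗ[S] LinearMap.ker φ) ≃ₗ[(Module.End S T)ᵐᵒᵖ] LinearMap.ker (homMap T φ) where
  toFun f := ⟨(LinearMap.ker φ).subtype ∘ₗ f, by ext x; simp⟩
  map_add' _ _ := rfl
  map_smul' _ _ := rfl
  invFun f := LinearMap.codRestrict _ f.1 fun x => LinearMap.congr_fun f.2 x
  left_inv _ := rfl
  right_inv _ := rfl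

theorem hasPD_hom_of_retract {n : ℕ} (h : HasPD (Module.End S T)ᵐᵒᵖ (T →ₗ[S] X) n)
    (i : Y →ₗ[S] X) (r : X →ₗ[S] Y) (hir : r ∘ₗ i = LinearMap.id) :
    HasPD (Module.End S T)ᵐᵒᵖ (T →ₗ[S] Y) n :=
  h.of_retract (homMap T i) (homMap T r) (by rw [← homMap_comp, hir, homMap_id])

theorem hasPD_hom_pi (m n : ℕ) : HasPD (Module.End S T)ᵐᵒᵖ (T →ₗ[S] (Fin m → T)) n :=
  have := projective_hom_pi (S := S) (T := T) m
  HasPD.of_projective n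

end HomFunctor

section Torsion

variable {S P₁ P₀ : Type} [Ring S] [AddCommGroup P₁] [Module S P₁] [AddCommGroup P₀] [Module S P₀]
  {d : P₁ →ₗ[S] P₀} {X Y W : Type} [AddCommGroup X] [Module S X] [AddCommGroup Y] [Module S Y]
  [AddCommGroup W] [Module S W]

/-- Every map `P₁ ⟶ X` factors through `d : P₁ ⟶ P₀`, that is, there are no nonzero maps from
the two-term complex given by `d` to `X[1]` in the derived category. -/
def IsTors (d : P₁ →ₗ[S] P₀) (X : Type) [AddCommGroup X] [Module S X] : Prop :=
  ∀ g : P₁ →ₗ[S] X, ∃ h : P₀ →ₗ[S] X, h ∘ₗ d = g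

/-- Every map `T ⟶ X` factors through `a : T^m ⟶ X`. -/
def IsApprox {T : Type} [AddCommGroup T] [Module S T] {m : ℕ} (a : (Fin m → T) →ₗ[S] X) : Prop :=
  ∀ u : T →ₗ[S] X, ∃ v : T →ₗ[S] (Fin m → T), a ∘ₗ v = u

theorem IsTors.of_surjective [Module.Projective S P₁] (hX : IsTors d X) (p : X →ₗ[S] Y)
    (hp : Function.Surjective p) : IsTors d Y := fun g => by
  obtain ⟨g', rfl⟩ := Module.projective_lifting_property p g hp
  obtain ⟨h, rfl⟩ := hX g'
  exact ⟨p ∘ₗ h, rfl⟩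

theorem IsTors.pi (hX : IsTors d X) (n : ℕ) : IsTors d (Fin n → X) := fun g => by
  choose h hh using fun i => hX (LinearMap.proj i ∘ₗ g)
  refine ⟨LinearMap.pi h, ?_⟩
  ext x i
  exact LinearMap.congr_fun (hh i) x

theorem IsTors.compLeft (hX : IsTors d X) (n : ℕ) : IsTors (d.compLeft (Fin n)) X := fun g => by
  choose h hh using fun i => hX (g ∘ₗ LinearMap.single S (fun _ => P₁) i)
  refine ⟨∑ i, h i ∘ₗ LinearMap.proj i, LinearMap.pi_ext' fun j => ?_⟩
  ext x
  have := LinearMap.congr_fun (hh j) x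
  simp only [LinearMap.comp_apply, LinearMap.sum_apply, LinearMap.proj_apply,
    LinearMap.compLeft_apply, Function.comp_apply, LinearMap.single_apply] at this ⊢
  rw [← this, Finset.sum_eq_single j]
  · simp
  · intro i _ hij
    simp [Pi.single_eq_of_ne hij]
  · simp

theorem exists_comp_mkQ_eq (h : P₀ →ₗ[S] X) (hd : h ∘ₗ d = 0) :
    ∃ u : (P₀ ⧸ LinearMap.range d) →ₗ[S] X, u ∘ₗ (LinearMap.range d).mkQ = h :=
  exists_comp_eq_of_ker_le _ (Submodule.mkQ_surjective _) h fun x hx => by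
    obtain ⟨y, rfl⟩ := (Submodule.Quotient.mk_eq_zero _).1 hx
    exact LinearMap.congr_fun hd y

@[simp]
theorem mk_range_apply (x : P₁) :
    (Submodule.Quotient.mk (d x) : P₀ ⧸ LinearMap.range d) = 0 :=
  (Submodule.Quotient.mk_eq_zero _).2 ⟨x, rfl⟩

/-- Maps from the cokernel of `d` lift along cokernels of maps from torsion modules. -/
theorem IsTors.exists_lift_of_ker_eq_range [Module.Projective S P₀] [Module.Projective S P₁]
    (hW : IsTors d W) (ψ : W →ₗ[S] X)
    (q : X →ₗ[S] Y) (hq : Function.Surjective q) (hψ : LinearMap.ker q = LinearMap.range ψ)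
    (u : (P₀ ⧸ LinearMap.range d) →ₗ[S] Y) :
    ∃ v : (P₀ ⧸ LinearMap.range d) →ₗ[S] X, q ∘ₗ v = u := by
  obtain ⟨v, hv⟩ := Module.projective_lifting_property q (u ∘ₗ (LinearMap.range d).mkQ) hq
  have hvd : ∀ x, v (d x) ∈ LinearMap.range ψ := fun x => by
    rw [← hψ, LinearMap.mem_ker]
    have := LinearMap.congr_fun hv (d x)
    simpa using this
  obtain ⟨g, hg⟩ := Module.projective_lifting_property ψ.rangeRestrict
    (LinearMap.codRestrict _ (v ∘ₗ d) hvd) ψ.surjective_rangeRestrict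
  obtain ⟨w, rfl⟩ := hW g
  obtain ⟨v', hv'⟩ := exists_comp_mkQ_eq (d := d) (v - ψ ∘ₗ w) <| by
    ext x
    have : ψ (w (d x)) = v (d x) := congr_arg Subtype.val (LinearMap.congr_fun hg x)
    simp [this]
  refine ⟨v', ?_⟩
  rw [← LinearMap.cancel_right (Submodule.mkQ_surjective (LinearMap.range d)),
    LinearMap.comp_assoc, hv', LinearMap.comp_sub, hv, ← LinearMap.comp_assoc,
    LinearMap.range_le_ker_iff.1 hψ.ge]
  simp

theorem IsTors.ker_of_isApprox {m : ℕ} (hT : IsTors d (P₀ ⧸ LinearMap.range d))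
    {a : (Fin m → P₀ ⧸ LinearMap.range d) →ₗ[S] X} (ha : IsApprox a) :
    IsTors d (LinearMap.ker a) := fun g => by
  obtain ⟨h, hh⟩ := hT.pi m ((LinearMap.ker a).subtype ∘ₗ g)
  obtain ⟨u, hu⟩ := exists_comp_mkQ_eq (d := d) (a ∘ₗ h) <| by
    rw [LinearMap.comp_assoc, hh]
    ext x
    simp
  obtain ⟨v, rfl⟩ := ha u
  refine ⟨LinearMap.codRestrict _ (h - v ∘ₗ (LinearMap.range d).mkQ) fun x => ?_, ?_⟩
  · rw [LinearMap.mem_ker]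
    exact (map_sub a _ _).trans (sub_eq_zero.2 (LinearMap.congr_fun hu x).symm)
  · ext x : 2
    have : h (d x) = g x := LinearMap.congr_fun hh x
    simp [this]

/-- Torsion modules admitting no nonzero maps from the cokernel of `d` vanish. -/
def Separates (d : P₁ →ₗ[S] P₀) : Prop :=
  ∀ (X : Type) [AddCommGroup X] [Module S X], IsTors d X →
    (∀ u : (P₀ ⧸ LinearMap.range d) →ₗ[S] X, u = 0) → Subsingleton X

theorem IsApprox.surjective [Module.Projective S P₀] [Module.Projective S P₁] {m : ℕ}
    (hT : IsTors d (P₀ ⧸ LinearMap.range d))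
    (hsep : Separates d) (hX : IsTors d X)
    {a : (Fin m → P₀ ⧸ LinearMap.range d) →ₗ[S] X} (ha : IsApprox a) : Function.Surjective a := by
  rw [← LinearMap.range_eq_top, ← Submodule.Quotient.subsingleton_iff]
  refine hsep _ (hX.of_surjective _ (Submodule.mkQ_surjective _)) fun u => ?_
  obtain ⟨v, rfl⟩ := (hT.pi m).exists_lift_of_ker_eq_range a (LinearMap.range a).mkQ
    (Submodule.mkQ_surjective _) (Submodule.ker_mkQ _) u
  obtain ⟨w, rfl⟩ := ha v
  ext x
  simp

variable [Module.Finite S P₀]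

theorem IsTors.exists_retract_of_hasPD_one (k : Type) [Field k] [Algebra k S] [FiniteDimensional k S]
    [Module.Projective S P₀] [Module.Projective S P₁]
    (hT : IsTors d (P₀ ⧸ LinearMap.range d)) (hsep : Separates d) (hX : IsTors d X)
    (hpd : HasPD S X 1) {m : ℕ}
    {a : (Fin m → P₀ ⧸ LinearMap.range d) →ₗ[S] X} (ha : IsApprox a) :
    ∃ (l : ℕ) (i : LinearMap.ker a →ₗ[S] (Fin l → P₀ ⧸ LinearMap.range d))
      (r : (Fin l → P₀ ⧸ LinearMap.range d) →ₗ[S] LinearMap.ker a), r ∘ₗ i = LinearMap.id := by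
  have hN : IsNoetherianRing S := IsNoetherianRing.of_finite k S
  obtain ⟨l, b, hb⟩ := exists_approx k (S := S) (P₀ ⧸ LinearMap.range d) (LinearMap.ker a)
  change IsApprox b at hb
  have hbt := hT.ker_of_isApprox hb
  have hbs := hb.surjective hT hsep (hT.ker_of_isApprox ha)
  let π : (Fin m → P₀) →ₗ[S] (Fin m → P₀ ⧸ LinearMap.range d) :=
    (LinearMap.range d).mkQ.compLeft (Fin m)
  have hπ : Function.Surjective π := (Submodule.mkQ_surjective _).comp_left
  have hK : Module.Projective S (LinearMap.ker (a ∘ₗ π)) :=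
    (HasPD.ker (n := 0) (a ∘ₗ π) ((ha.surjective hT hsep hX).comp hπ)
      ((HasPD.of_projective 0).pi m) hpd).projective
  let ρ : LinearMap.ker (a ∘ₗ π) →ₗ[S] LinearMap.ker a :=
    LinearMap.codRestrict _ (π ∘ₗ (LinearMap.ker (a ∘ₗ π)).subtype) fun x => x.2
  have hρ : Function.Surjective ρ := by
    rintro ⟨y, hy⟩
    obtain ⟨x, rfl⟩ := hπ y
    exact ⟨⟨x, hy⟩, rfl⟩
  obtain ⟨s, hs⟩ := Module.projective_lifting_property b ρ hbs
  have hπd : ∀ x, π (d.compLeft (Fin m) x) = 0 := fun x => by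
    ext i
    simp [π]
  let D : (Fin m → P₁) →ₗ[S] LinearMap.ker (a ∘ₗ π) :=
    LinearMap.codRestrict _ (d.compLeft (Fin m)) fun x => by
      rw [LinearMap.mem_ker, LinearMap.comp_apply, hπd, map_zero]
  obtain ⟨e, he⟩ := hbt.compLeft m (LinearMap.codRestrict (LinearMap.ker b) (s ∘ₗ D) fun x => by
    rw [LinearMap.mem_ker]
    refine (LinearMap.congr_fun hs (D x)).trans (Subtype.ext (hπd x)))
  obtain ⟨σ, hσ⟩ := exists_comp_eq_of_ker_le ρ hρ
      (s - (LinearMap.ker b).subtype ∘ₗ e ∘ₗ (LinearMap.ker (a ∘ₗ π)).subtype) fun x hx => by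
    have hx' : ∀ i, x.1 i ∈ LinearMap.range d := fun i =>
      (Submodule.Quotient.mk_eq_zero _).1 (congr_fun (congr_arg Subtype.val hx) i)
    choose y hy using hx'
    have hxy : D y = x := Subtype.ext (funext hy)
    have := congr_arg Subtype.val (LinearMap.congr_fun he y)
    subst hxy
    exact sub_eq_zero.2 this.symm
  refine ⟨l, σ, b, ?_⟩
  rw [← LinearMap.cancel_right hρ, LinearMap.comp_assoc, hσ, LinearMap.comp_sub, hs]
  ext x
  simp

theorem IsTors.hasPD_hom (k : Type) [Field k] [Algebra k S] [FiniteDimensional k S]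
    [Module.Projective S P₀] [Module.Projective S P₁]
    (hT : IsTors d (P₀ ⧸ LinearMap.range d)) (hsep : Separates d)
    (hpdT : HasPD S (P₀ ⧸ LinearMap.range d) 1) (n : ℕ) (X : Type) [AddCommGroup X] [Module S X]
    [Module.Finite S X] (hX : IsTors d X) (hpd : HasPD S X n) :
    HasPD (Module.End S (P₀ ⧸ LinearMap.range d))ᵐᵒᵖ ((P₀ ⧸ LinearMap.range d) →ₗ[S] X) n := by
  have hN : IsNoetherianRing S := IsNoetherianRing.of_finite k S
  obtain ⟨m, a, ha⟩ := exists_approx k (S := S) (P₀ ⧸ LinearMap.range d) X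
  change IsApprox a at ha
  have has := ha.surjective hT hsep hX
  induction n generalizing X m with
  | zero =>
    have := hpd.projective
    obtain ⟨i, hi⟩ := Module.projective_lifting_property a LinearMap.id has
    exact hasPD_hom_of_retract (hasPD_hom_pi m 0) i a hi
  | succ n ih =>
    have key : HasPD (Module.End S (P₀ ⧸ LinearMap.range d))ᵐᵒᵖ
        ((P₀ ⧸ LinearMap.range d) →ₗ[S] LinearMap.ker a) n := by
      cases n with
      | zero =>
        obtain ⟨l, i, r, hir⟩ := hT.exists_retract_of_hasPD_one k hsep hX hpd ha
        exact hasPD_hom_of_retract (hasPD_hom_pi l 0) i r hir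
      | succ n =>
        have hk := hT.ker_of_isApprox ha
        obtain ⟨m', a', ha'⟩ :=
          exists_approx k (S := S) (P₀ ⧸ LinearMap.range d) (LinearMap.ker a)
        exact ih _ hk (HasPD.ker a has ((hpdT.pi m).mono (by omega)) hpd) m' a' ha'
          (IsApprox.surjective hT hsep hk ha')
    exact HasPD.of_surjective (homMap _ a) (fun u => ha u) (key.of_equiv (homKerEquiv _ a))
      (hasPD_hom_pi m _)

theorem IsTors.hasPD_of_finite (k : Type) [Field k] [Algebra k S] [FiniteDimensional k S]
    [Module.Projective S P₀] [Module.Projective S P₁]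
    (hT : IsTors d (P₀ ⧸ LinearMap.range d)) (hsep : Separates d)
    (hpdT : HasPD S (P₀ ⧸ LinearMap.range d) 1) (n : ℕ)
    (hS : ∀ (X : Type) [AddCommGroup X] [Module S X] [Module.Finite S X], HasPD S X n)
    (N : Type) [AddCommGroup N] [Module (Module.End S (P₀ ⧸ LinearMap.range d))ᵐᵒᵖ N]
    [Module.Finite (Module.End S (P₀ ⧸ LinearMap.range d))ᵐᵒᵖ N] :
    HasPD (Module.End S (P₀ ⧸ LinearMap.range d))ᵐᵒᵖ N (n + 1) := by
  have hN : IsNoetherianRing S := IsNoetherianRing.of_finite k S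
  have := isNoetherianRing_endOp (T := P₀ ⧸ LinearMap.range d) (S := S) k
  obtain ⟨l, m, φ, q, hq, hφ⟩ := exists_hom_presentation (T := P₀ ⧸ LinearMap.range d) (S := S) N
  refine HasPD.of_surjective q hq ?_ (hasPD_hom_pi l _)
  obtain ⟨r, ψ, hψ⟩ := exists_approx k (S := S) (P₀ ⧸ LinearMap.range d) (LinearMap.ker φ)
  let ψ' := (LinearMap.ker φ).subtype ∘ₗ ψ
  let p := (LinearMap.range ψ').mkQ
  have hp : Function.Surjective p := Submodule.mkQ_surjective _
  have key := hT.hasPD_hom k hsep hpdT n _ ((hT.pi m).of_surjective p hp) (hS _)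
  obtain ⟨φ', hφ'⟩ := exists_comp_eq_of_ker_le p hp φ fun x hx => by
    obtain ⟨y, rfl⟩ := (Submodule.Quotient.mk_eq_zero _).1 hx
    exact (ψ y).2
  have hpF : Function.Surjective (homMap (P₀ ⧸ LinearMap.range d) p) := fun u =>
    (hT.pi r).exists_lift_of_ker_eq_range ψ' p hp (Submodule.ker_mkQ _) u
  have hinj : Function.Injective (homMap (P₀ ⧸ LinearMap.range d) φ') := by
    rw [injective_iff_map_eq_zero]
    intro u hu
    obtain ⟨v, rfl⟩ := hpF u
    have hv : φ ∘ₗ v = 0 := by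
      rw [← hφ']
      exact hu
    obtain ⟨w, hw⟩ := hψ (LinearMap.codRestrict _ v fun x => LinearMap.congr_fun hv x)
    ext x
    refine (Submodule.Quotient.mk_eq_zero _).2 ⟨w ((LinearMap.range d).mkQ x), ?_⟩
    exact congr_arg Subtype.val (LinearMap.congr_fun hw ((LinearMap.range d).mkQ x))
  refine key.of_equiv ((LinearEquiv.ofInjective _ hinj).trans (LinearEquiv.ofEq _ _ ?_))
  rw [hφ, ← hφ', homMap_comp]
  exact (LinearMap.range_comp_of_range_eq_top _ (LinearMap.range_eq_top.2 hpF)).symm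

end Torsion

section Kernel

variable {S P₁ P₀ : Type} [Ring S] [AddCommGroup P₁] [Module S P₁] [AddCommGroup P₀] [Module S P₀]
  {d : P₁ →ₗ[S] P₀} {X Y : Type} [AddCommGroup X] [Module S X] [AddCommGroup Y] [Module S Y]

theorem projective_range_of_hasPD_quotient [Module.Projective S P₀]
    (hpdT : HasPD S (P₀ ⧸ LinearMap.range d) 1) : Module.Projective S (LinearMap.range d) :=
  ((HasPD.ker (n := 0) _ (Submodule.mkQ_surjective (LinearMap.range d)) (HasPD.of_projective 0)
    hpdT).of_equiv (LinearEquiv.ofEq _ _ (Submodule.ker_mkQ _))).projective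

theorem exists_ker_retraction [Module.Projective S (LinearMap.range d)] :
    ∃ r : P₁ →ₗ[S] LinearMap.ker d, r ∘ₗ (LinearMap.ker d).subtype = LinearMap.id := by
  obtain ⟨s, hs⟩ := Module.projective_lifting_property d.rangeRestrict LinearMap.id
    d.surjective_rangeRestrict
  refine ⟨LinearMap.codRestrict _ (LinearMap.id - s ∘ₗ d.rangeRestrict) fun x => ?_, ?_⟩
  · have : d (s (d.rangeRestrict x)) = d x :=
      congr_arg Subtype.val (LinearMap.congr_fun hs (d.rangeRestrict x))
    simp [this]
  · ext x
    have : d.rangeRestrict x.1 = 0 := Subtype.ext x.2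
    simp [this]

theorem projective_ker [Module.Projective S P₁] [Module.Projective S (LinearMap.range d)] :
    Module.Projective S (LinearMap.ker d) := by
  obtain ⟨r, hr⟩ := exists_ker_retraction (d := d)
  exact Module.Projective.of_split _ r hr

theorem IsTors.hom_ker_eq_zero [Module.Projective S (LinearMap.range d)] (hX : IsTors d X)
    (u : LinearMap.ker d →ₗ[S] X) : u = 0 := by
  obtain ⟨r, hr⟩ := exists_ker_retraction (d := d)
  obtain ⟨h, hh⟩ := hX (u ∘ₗ r)
  rw [← LinearMap.comp_id u, ← hr, ← LinearMap.comp_assoc, ← hh]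
  ext x
  simp

/-- A torsion extension of powers of the cokernel of `d` by `X`, given by a pushout. -/
theorem exists_tors_pushout (k : Type) [Field k] [Algebra k S] [FiniteDimensional k S]
    [Module.Finite S P₁]
    [Module.Projective S P₀] [Module.Projective S P₁]
    (hT : IsTors d (P₀ ⧸ LinearMap.range d)) [Module.Finite S X] :
    ∃ (r : ℕ) (g : (Fin r → P₁) →ₗ[S] X),
      IsTors d ((X × (Fin r → P₀)) ⧸ LinearMap.range (g.prod (-d.compLeft (Fin r)))) := by
  obtain ⟨r, x, hx⟩ := exists_span_hom k (S := S) P₁ X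
  let g : (Fin r → P₁) →ₗ[S] X := ∑ i, x i ∘ₗ LinearMap.proj i
  refine ⟨r, g, fun γ => ?_⟩
  let D := d.compLeft (Fin r)
  let p := (LinearMap.range (g.prod (-D))).mkQ
  have hpg : ∀ y, p (g y, 0) = p (0, D y) := fun y =>
    (Submodule.Quotient.eq _).2 ⟨y, by ext <;> simp [D]⟩
  obtain ⟨γ', rfl⟩ := Module.projective_lifting_property p γ (Submodule.mkQ_surjective _)
  obtain ⟨h, hh⟩ := hT.pi r
    ((LinearMap.range d).mkQ.compLeft (Fin r) ∘ₗ LinearMap.snd S _ _ ∘ₗ γ')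
  obtain ⟨h', rfl⟩ := Module.projective_lifting_property ((LinearMap.range d).mkQ.compLeft (Fin r)) h
    (Submodule.mkQ_surjective _).comp_left
  have hmem : ∀ y, (LinearMap.snd S _ _ ∘ₗ γ' - h' ∘ₗ d) y ∈ LinearMap.range D := fun y => by
    have hy : ∀ i, ((LinearMap.snd S _ _ ∘ₗ γ' - h' ∘ₗ d) y) i ∈ LinearMap.range d := fun i =>
      (Submodule.Quotient.eq _).1 (congr_fun (LinearMap.congr_fun hh y) i).symm
    choose z hz using hy
    exact ⟨z, funext hz⟩
  obtain ⟨δ, hδ⟩ := Module.projective_lifting_property D.rangeRestrict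
    (LinearMap.codRestrict _ _ hmem) D.surjective_rangeRestrict
  have hδ' : ∀ y, D (δ y) = (γ' y).2 - h' (d y) := fun y =>
    congr_arg Subtype.val (LinearMap.congr_fun hδ y)
  obtain ⟨c, hc⟩ := hx (LinearMap.fst S _ _ ∘ₗ γ' + g ∘ₗ δ)
  have hc' : ∀ y, (γ' y).1 + g (δ y) = g (fun i => scalarEnd k (S := S) P₁ (c i) y) := fun y =>
    (LinearMap.congr_fun hc y).trans (by simp [g])
  refine ⟨p ∘ₗ LinearMap.inr S _ _ ∘ₗ
    (h' + LinearMap.pi fun i => scalarEnd k (S := S) P₀ (c i)), LinearMap.ext fun y => ?_⟩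
  have h₁ : γ' y = (g (fun i => scalarEnd k (S := S) P₁ (c i) y), 0) + (0, h' (d y))
      - ((g (δ y), 0) - (0, D (δ y))) := by
    ext1
    · exact (eq_sub_of_add_eq (hc' y)).trans (by simp)
    · simp [hδ']
  have h₂ : D (fun i => scalarEnd k (S := S) P₁ (c i) y) = fun i => scalarEnd k (S := S) P₀ (c i) (d y) := by
    ext i
    simp [D]
  have h₃ : p (γ' y) = p (0, D (fun i => scalarEnd k (S := S) P₁ (c i) y)) + p (0, h' (d y)) := by
    rw [h₁, map_sub, map_add, map_sub, hpg, hpg, sub_self, sub_zero]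
  change p _ = p (γ' y)
  rw [h₃, h₂, ← map_add]
  congr 1
  ext i
  · simp
  · simp [add_comm]

variable [Module.Finite S P₀]

theorem hasPD_pushout (k : Type) [Field k] [Algebra k S] [FiniteDimensional k S]
    [Module.Projective S P₀] [Module.Projective S P₁]
    (hT : IsTors d (P₀ ⧸ LinearMap.range d)) (hsep : Separates d)
    (hpdT : HasPD S (P₀ ⧸ LinearMap.range d) 1) [Module.Finite S X] [Module.Projective S X]
    {r : ℕ} {g : (Fin r → P₁) →ₗ[S] X}
    (hU : IsTors d ((X × (Fin r → P₀)) ⧸ LinearMap.range (g.prod (-d.compLeft (Fin r))))) :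
    HasPD S ((X × (Fin r → P₀)) ⧸ LinearMap.range (g.prod (-d.compLeft (Fin r)))) 1 := by
  let D := d.compLeft (Fin r)
  let p := (LinearMap.range (g.prod (-D))).mkQ
  have hp : Function.Surjective p := Submodule.mkQ_surjective _
  have hpg : ∀ y, p (g y, 0) = p (0, D y) := fun y =>
    (Submodule.Quotient.eq _).2 ⟨y, by ext <;> simp [D]⟩
  obtain ⟨m, a, ha⟩ := exists_approx k (S := S) (P₀ ⧸ LinearMap.range d)
    ((X × (Fin r → P₀)) ⧸ LinearMap.range (g.prod (-d.compLeft (Fin r))))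
  change IsApprox a at ha
  have hproj : Module.Projective S (Fin r → P₀) := projective_pi r
  obtain ⟨v, hv⟩ := Module.projective_lifting_property a p (ha.surjective hT hsep hU)
  obtain ⟨w, hw⟩ := (hT.ker_of_isApprox ha).compLeft r
    (LinearMap.codRestrict _ (v ∘ₗ g.prod (-D)) fun y => by
      refine (LinearMap.congr_fun hv _).trans ?_
      exact (Submodule.Quotient.mk_eq_zero _).2 ⟨y, rfl⟩)
  obtain ⟨σ, hσ⟩ := exists_comp_eq_of_ker_le p hp
    (v + (LinearMap.ker a).subtype ∘ₗ w ∘ₗ LinearMap.snd S _ _) fun x hx => by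
      obtain ⟨y, rfl⟩ := (Submodule.Quotient.mk_eq_zero _).1 hx
      have : (w (D y)).1 = v (g y, -D y) := congr_arg Subtype.val (LinearMap.congr_fun hw y)
      simp [D] at this ⊢
      simp [this]
  refine (hpdT.pi m).of_retract σ a ?_
  rw [← LinearMap.cancel_right hp, LinearMap.comp_assoc, hσ, LinearMap.comp_add, hv]
  ext x <;> simp

theorem projective_hom_ker (k : Type) [Field k] [Algebra k S] [FiniteDimensional k S]
    [Module.Finite S P₁]
    [Module.Projective S P₀] [Module.Projective S P₁]
    (hT : IsTors d (P₀ ⧸ LinearMap.range d)) (hsep : Separates d)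
    (hpdT : HasPD S (P₀ ⧸ LinearMap.range d) 1) [Module.Finite S X] [Module.Projective S X] :
    Module.Projective (Module.End S (LinearMap.ker d))ᵐᵒᵖ (LinearMap.ker d →ₗ[S] X) := by
  have := projective_range_of_hasPD_quotient hpdT
  obtain ⟨r, g, hU⟩ := exists_tors_pushout k hT (X := X)
  have hpU := hasPD_pushout k hT hsep hpdT hU
  let N := LinearMap.range (g.prod (-d.compLeft (Fin r)))
  let ι : X →ₗ[S] (X × (Fin r → P₀)) ⧸ N := N.mkQ ∘ₗ LinearMap.inl S _ _
  obtain ⟨pr, hpr⟩ := exists_comp_eq_of_ker_le N.mkQ N.mkQ_surjective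
    ((LinearMap.range d).mkQ.compLeft (Fin r) ∘ₗ LinearMap.snd S _ _) fun x hx => by
      obtain ⟨y, rfl⟩ := (Submodule.Quotient.mk_eq_zero _).1 hx
      ext i
      simp
  have hprs : Function.Surjective pr := by
    refine Function.Surjective.of_comp (g := N.mkQ) ?_
    rw [← LinearMap.coe_comp, hpr]
    exact (Submodule.mkQ_surjective _).comp_left.comp Prod.snd_surjective
  have hpι : ∀ x, pr (ι x) = 0 := fun x => by
    refine (LinearMap.congr_fun hpr (x, 0)).trans ?_
    simp
  have hker : HasPD S (LinearMap.ker ι) 0 := by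
    have h₁ : HasPD S (LinearMap.ker pr) 1 :=
      HasPD.ker pr hprs hpU ((hpdT.pi r).mono one_le_two)
    let ι' : X →ₗ[S] LinearMap.ker pr := LinearMap.codRestrict _ ι hpι
    have hι' : Function.Surjective ι' := by
      rintro ⟨u, hu⟩
      obtain ⟨⟨x, z⟩, rfl⟩ := N.mkQ_surjective u
      have hz : ∀ i, z i ∈ LinearMap.range d := fun i =>
        (Submodule.Quotient.mk_eq_zero _).1
          (congr_fun ((LinearMap.congr_fun hpr (x, z)).symm.trans hu) i)
      choose y hy using hz
      refine ⟨x + g y, Subtype.ext ((Submodule.Quotient.eq _).2 ⟨y, ?_⟩)⟩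
      ext i
      · simp
      · simp [hy]
    refine (HasPD.ker ι' hι' (HasPD.of_projective 0) h₁).of_equiv
      (LinearEquiv.ofEq _ _ (LinearMap.ker_codRestrict _ _ _))
  have := hker.projective
  let θ : (Fin r → LinearMap.ker d) →ₗ[S] LinearMap.ker ι :=
    LinearMap.codRestrict _ (g ∘ₗ (LinearMap.ker d).subtype.compLeft (Fin r)) fun y => by
      refine (Submodule.Quotient.mk_eq_zero _).2 ⟨fun i => (y i).1, ?_⟩
      ext i
      · simp; rfl
      · simp
  have hθ : Function.Surjective θ := by
    rintro ⟨x, hx⟩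
    obtain ⟨y, hy⟩ := (Submodule.Quotient.mk_eq_zero _).1 hx
    have hy₂ : ∀ i, d (y i) = 0 := fun i => by
      simpa using congr_fun (congr_arg Prod.snd hy) i
    exact ⟨fun i => ⟨y i, hy₂ i⟩, Subtype.ext (congr_arg Prod.fst hy)⟩
  obtain ⟨s, hs⟩ := Module.projective_lifting_property θ LinearMap.id hθ
  have key := hasPD_hom_of_retract (hasPD_hom_pi r 0) s θ hs
  have htop : LinearMap.ker (homMap (LinearMap.ker d) ι) = ⊤ := by
    rw [LinearMap.ker_eq_top]
    ext1 u
    exact hU.hom_ker_eq_zero _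
  exact (key.of_equiv (((homKerEquiv _ ι).trans (LinearEquiv.ofEq _ _ htop)).trans
    Submodule.topEquiv)).projective

theorem homMap_surjective {T : Type} [AddCommGroup T] [Module S T] [Module.Projective S T]
    (p : X →ₗ[S] Y) (hp : Function.Surjective p) : Function.Surjective (homMap T p) :=
  fun u => Module.projective_lifting_property p u hp

theorem hasPD_hom_ker (k : Type) [Field k] [Algebra k S] [FiniteDimensional k S]
    [Module.Finite S P₁]
    [Module.Projective S P₀] [Module.Projective S P₁]
    (hT : IsTors d (P₀ ⧸ LinearMap.range d)) (hsep : Separates d)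
    (hpdT : HasPD S (P₀ ⧸ LinearMap.range d) 1) (n : ℕ) (X : Type) [AddCommGroup X] [Module S X]
    [Module.Finite S X] (hX : HasPD S X n) :
    HasPD (Module.End S (LinearMap.ker d))ᵐᵒᵖ (LinearMap.ker d →ₗ[S] X) n := by
  have hN : IsNoetherianRing S := IsNoetherianRing.of_finite k S
  have := projective_range_of_hasPD_quotient hpdT
  have := projective_ker (d := d)
  induction n generalizing X with
  | zero =>
    have := hX.projective
    have := projective_hom_ker k hT hsep hpdT (X := X)
    exact HasPD.of_projective 0
  | succ n ih =>
    obtain ⟨m, p, hp⟩ := Module.Finite.exists_fin' S X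
    have := projective_hom_ker k hT hsep hpdT (X := Fin m → S)
    exact HasPD.of_surjective (homMap _ p) (homMap_surjective p hp)
      ((ih _ (HasPD.ker p hp (HasPD.of_projective n) hX)).of_equiv (homKerEquiv _ p))
      (HasPD.of_projective _)

theorem hasPD_end_ker_of_finite (k : Type) [Field k] [Algebra k S] [FiniteDimensional k S]
    [Module.Finite S P₁]
    [Module.Projective S P₀] [Module.Projective S P₁]
    (hT : IsTors d (P₀ ⧸ LinearMap.range d)) (hsep : Separates d)
    (hpdT : HasPD S (P₀ ⧸ LinearMap.range d) 1) (n : ℕ)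
    (hS : ∀ (X : Type) [AddCommGroup X] [Module S X] [Module.Finite S X], HasPD S X n)
    (N : Type) [AddCommGroup N] [Module (Module.End S (LinearMap.ker d))ᵐᵒᵖ N]
    [Module.Finite (Module.End S (LinearMap.ker d))ᵐᵒᵖ N] :
    HasPD (Module.End S (LinearMap.ker d))ᵐᵒᵖ N n := by
  have hN : IsNoetherianRing S := IsNoetherianRing.of_finite k S
  have := projective_range_of_hasPD_quotient hpdT
  have := projective_ker (d := d)
  have := isNoetherianRing_endOp (T := LinearMap.ker d) (S := S) k
  obtain ⟨l, m, φ, q, hq, hφ⟩ := exists_hom_presentation (T := LinearMap.ker d) (S := S) N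
  have key := hasPD_hom_ker k hT hsep hpdT n _ (hS ((Fin l → LinearMap.ker d) ⧸ LinearMap.range φ))
  let p := homMap (LinearMap.ker d) (LinearMap.range φ).mkQ
  have hp : Function.Surjective p := homMap_surjective _ (Submodule.mkQ_surjective _)
  have hpφ : LinearMap.ker p = LinearMap.ker q := by
    rw [hφ]
    ext u
    refine ⟨fun hu => ?_, ?_⟩
    · have hu' : ∀ x, u x ∈ LinearMap.range φ := fun x =>
        (Submodule.Quotient.mk_eq_zero _).1 (LinearMap.congr_fun hu x)
      obtain ⟨v, hv⟩ := Module.projective_lifting_property φ.rangeRestrict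
        (LinearMap.codRestrict _ u hu') φ.surjective_rangeRestrict
      exact ⟨v, LinearMap.ext fun x => congr_arg Subtype.val (LinearMap.congr_fun hv x)⟩
    · rintro ⟨v, rfl⟩
      ext x
      simp [p]
  exact key.of_equiv ((p.quotKerEquivOfSurjective hp).symm.trans
    ((Submodule.quotEquivOfEq _ _ hpφ).trans (q.quotKerEquivOfSurjective hq)))

end Kernel

section ChainEnd

variable {S P₁ P₀ : Type} [Ring S] [AddCommGroup P₁] [Module S P₁] [AddCommGroup P₀] [Module S P₀]

/-- The ring of chain endomorphisms of the two-term complex `d`. -/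
def chainEnd (d : P₁ →ₗ[S] P₀) : Subring (Module.End S P₁ × Module.End S P₀) where
  carrier := {x | d ∘ₗ x.1 = x.2 ∘ₗ d}
  zero_mem' := by simp
  one_mem' := rfl
  add_mem' {x y} hx hy := by
    change d ∘ₗ (x.1 + y.1) = (x.2 + y.2) ∘ₗ d
    rw [LinearMap.comp_add, LinearMap.add_comp, hx, hy]
  neg_mem' {x} hx := by
    change d ∘ₗ (-x.1) = (-x.2) ∘ₗ d
    rw [LinearMap.comp_neg, LinearMap.neg_comp, hx]
  mul_mem' {x y} hx hy := by
    change d ∘ₗ (x.1 ∘ₗ y.1) = (x.2 ∘ₗ y.2) ∘ₗ d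
    rw [← LinearMap.comp_assoc, hx, LinearMap.comp_assoc, hy, LinearMap.comp_assoc]

variable {d : P₁ →ₗ[S] P₀}

theorem chainEnd.comm_apply (x : chainEnd d) (y : P₁) : d (x.1.1 y) = x.1.2 (d y) :=
  LinearMap.congr_fun x.2 y

/-- The action of chain endomorphisms on the cokernel. -/
def chainEnd.coker : chainEnd d →+* Module.End S (P₀ ⧸ LinearMap.range d) where
  toFun x := Submodule.mapQ _ _ x.1.2 (by
    rintro _ ⟨y, rfl⟩
    exact ⟨x.1.1 y, chainEnd.comm_apply x y⟩)
  map_one' := by ext; rfl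
  map_mul' _ _ := by ext; rfl
  map_zero' := by ext; rfl
  map_add' _ _ := by ext; rfl

/-- The action of chain endomorphisms on the kernel. -/
def chainEnd.onKer : chainEnd d →+* Module.End S (LinearMap.ker d) where
  toFun x := x.1.1.restrict (p := LinearMap.ker d) (q := LinearMap.ker d) fun y hy => by
    rw [LinearMap.mem_ker] at hy ⊢
    rw [chainEnd.comm_apply, hy, map_zero]
  map_one' := by ext; rfl
  map_mul' _ _ := by ext; rfl
  map_zero' := by ext; rfl
  map_add' _ _ := by ext; rfl

theorem chainEnd.coker_surjective [Module.Projective S P₀] [Module.Projective S P₁] :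
    Function.Surjective (chainEnd.coker (d := d)) := by
  intro u
  obtain ⟨b, hb⟩ := Module.projective_lifting_property (LinearMap.range d).mkQ
    (u ∘ₗ (LinearMap.range d).mkQ) (Submodule.mkQ_surjective _)
  obtain ⟨a, ha⟩ := Module.projective_lifting_property d.rangeRestrict
    (LinearMap.codRestrict _ (b ∘ₗ d) fun y => by
      refine (Submodule.Quotient.mk_eq_zero _).1 ((LinearMap.congr_fun hb (d y)).trans ?_)
      simp) d.surjective_rangeRestrict
  refine ⟨⟨(a, b), LinearMap.ext fun y => congr_arg Subtype.val (LinearMap.congr_fun ha y)⟩, ?_⟩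
  ext y
  exact LinearMap.congr_fun hb y

theorem chainEnd.onKer_surjective [Module.Projective S (LinearMap.range d)] :
    Function.Surjective (chainEnd.onKer (d := d)) := by
  intro v
  obtain ⟨r, hr⟩ := exists_ker_retraction (d := d)
  refine ⟨⟨((LinearMap.ker d).subtype ∘ₗ v ∘ₗ r, 0), ?_⟩, ?_⟩
  · change d ∘ₗ _ = 0 ∘ₗ d
    ext y
    simp
  · ext y
    have : r y = y := LinearMap.congr_fun hr y
    change (v (r y) : P₁) = v y
    rw [this]

theorem isNoetherianRing_chainEnd (k : Type) [Field k] [Algebra k S] [FiniteDimensional k S]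
    [Module.Finite S P₁] [Module.Finite S P₀] : IsNoetherianRing (chainEnd d)ᵐᵒᵖ := by
  let : Module k P₁ := Module.compHom P₁ (algebraMap k S)
  have : IsScalarTower k S P₁ := IsScalarTower.of_algebraMap_smul fun _ _ => rfl
  have : SMulCommClass S k P₁ := ⟨fun s c n => by
    change s • algebraMap k S c • n = algebraMap k S c • s • n
    rw [smul_smul, smul_smul, Algebra.commutes]⟩
  let : Module k P₀ := Module.compHom P₀ (algebraMap k S)
  have : IsScalarTower k S P₀ := IsScalarTower.of_algebraMap_smul fun _ _ => rfl
  have : SMulCommClass S k P₀ := ⟨fun s c n => by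
    change s • algebraMap k S c • n = algebraMap k S c • s • n
    rw [smul_smul, smul_smul, Algebra.commutes]⟩
  have : SMulCommClass k S P₁ := SMulCommClass.symm _ _ _
  have : SMulCommClass k S P₀ := SMulCommClass.symm _ _ _
  have := finite_linearMap k (S := S) P₁ P₁
  have := finite_linearMap k (S := S) P₀ P₀
  let C : Subalgebra k (Module.End S P₁ × Module.End S P₀) :=
    { chainEnd d with
      algebraMap_mem' := fun c => by
        change d ∘ₗ _ = _ ∘ₗ d
        ext y
        change d (algebraMap k S c • y) = algebraMap k S c • d y
        exact map_smul _ _ _ }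
  have : Module.Finite k (Module.End S P₁ × Module.End S P₀) := Module.Finite.prod
  have : FiniteDimensional k C := FiniteDimensional.finiteDimensional_submodule C.toSubmodule
  have : FiniteDimensional k Cᵐᵒᵖ := inferInstance
  exact IsNoetherianRing.of_finite k Cᵐᵒᵖ

theorem hasPD_of_chainEnd_quotient (k : Type) [Field k] [Algebra k S] [FiniteDimensional k S]
    [Module.Finite S P₁] [Module.Finite S P₀]
    [Module.Projective S P₀] [Module.Projective S P₁]
    (hT : IsTors d (P₀ ⧸ LinearMap.range d)) (hsep : Separates d)
    (hpdT : HasPD S (P₀ ⧸ LinearMap.range d) 1) (n : ℕ)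
    (hS : ∀ (X : Type) [AddCommGroup X] [Module S X] [Module.Finite S X], HasPD S X n)
    {R : Type w} [Ring R] (ρ : chainEnd d →+* R) (hρ : Function.Surjective ρ)
    (hρ₀ : ∀ x, ρ x = 0 ↔ ∃ h : P₀ →ₗ[S] P₁, x.1.1 = h ∘ₗ d ∧ x.1.2 = d ∘ₗ h)
    (M : Type w) [AddCommGroup M] [Module Rᵐᵒᵖ M] [Module.Finite Rᵐᵒᵖ M] :
    HasPD Rᵐᵒᵖ M (n + (n + 1 + 1)) := by
  have := projective_range_of_hasPD_quotient hpdT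
  obtain ⟨s, hs⟩ := Module.projective_lifting_property d.rangeRestrict LinearMap.id
    d.surjective_rangeRestrict
  have hs' : ∀ y, d (s y) = y := fun y => congr_arg Subtype.val (LinearMap.congr_fun hs y)
  let b : chainEnd d := ⟨(s ∘ₗ d.rangeRestrict, 1), LinearMap.ext fun y => hs' _⟩
  let π' := ρ.liftOfSurjective hρ ⟨chainEnd.coker, fun x hx => by
    obtain ⟨h, -, h₂⟩ := (hρ₀ x).1 hx
    refine LinearMap.ext fun y => ?_
    obtain ⟨y, rfl⟩ := Submodule.mkQ_surjective _ y
    refine (Submodule.Quotient.mk_eq_zero _).2 ?_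
    rw [h₂]
    exact ⟨h y, rfl⟩⟩
  have hπ' : ∀ x, π' (ρ x) = chainEnd.coker x := ρ.liftOfSurjective_comp_apply hρ _
  let ε' := ρ.liftOfSurjective hρ ⟨chainEnd.onKer, fun x hx => by
    obtain ⟨h, h₁, -⟩ := (hρ₀ x).1 hx
    refine LinearMap.ext fun y => Subtype.ext ?_
    change x.1.1 y.1 = 0
    rw [h₁, LinearMap.comp_apply, LinearMap.mem_ker.1 y.2, map_zero]⟩
  have hε' : ∀ x, ε' (ρ x) = chainEnd.onKer x := ρ.liftOfSurjective_comp_apply hρ _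
  have := isNoetherianRing_chainEnd k (d := d)
  have hN : IsNoetherianRing Rᵐᵒᵖ := isNoetherianRing_of_surjective _ _ ρ.op
    (fun y => by
      obtain ⟨x, hx⟩ := hρ y.unop
      exact ⟨MulOpposite.op x, MulOpposite.unop_injective hx⟩)
  refine hasPD_of_triangular (RingHom.op π') ?_ (RingHom.op ε') ?_ (MulOpposite.op (ρ b))
    ?_ ?_ ?_
    (fun N _ _ _ => hT.hasPD_of_finite k hsep hpdT n hS N)
    (fun N _ _ _ => hasPD_end_ker_of_finite k hT hsep hpdT n hS N) M
  · intro u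
    obtain ⟨x, hx⟩ := chainEnd.coker_surjective u.unop
    exact ⟨MulOpposite.op (ρ x), MulOpposite.unop_injective ((hπ' x).trans hx)⟩
  · intro u
    obtain ⟨x, hx⟩ := chainEnd.onKer_surjective u.unop
    exact ⟨MulOpposite.op (ρ x), MulOpposite.unop_injective ((hε' x).trans hx)⟩
  · refine MulOpposite.unop_injective ((hπ' b).trans ?_)
    refine LinearMap.ext fun y => ?_
    obtain ⟨y, rfl⟩ := Submodule.mkQ_surjective _ y
    rfl
  · intro y hy
    obtain ⟨x, hx⟩ := hρ y.unop
    obtain rfl : y = MulOpposite.op (ρ x) := MulOpposite.unop_injective hx.symm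
    have hx₀ : chainEnd.coker x = 0 := (hπ' x).symm.trans (congr_arg MulOpposite.unop hy)
    have hmem : ∀ z, x.1.2 z ∈ LinearMap.range d := fun z =>
      (Submodule.Quotient.mk_eq_zero _).1
        (LinearMap.congr_fun hx₀ ((LinearMap.range d).mkQ z))
    refine MulOpposite.unop_injective ?_
    change ρ b * ρ x = 0
    rw [← map_mul, hρ₀]
    refine ⟨s ∘ₗ LinearMap.codRestrict _ x.1.2 hmem, ?_, ?_⟩
    · ext z
      refine congr_arg s (Subtype.ext ?_)
      exact chainEnd.comm_apply x z
    · ext z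
      exact (hs' (LinearMap.codRestrict _ x.1.2 hmem z)).symm
  · intro y hy
    obtain ⟨x, hx⟩ := hρ y.unop
    obtain rfl : y = MulOpposite.op (ρ x) := MulOpposite.unop_injective hx.symm
    have hx₀ : chainEnd.onKer x = 0 := (hε' x).symm.trans (congr_arg MulOpposite.unop hy)
    refine MulOpposite.unop_injective ?_
    change ρ x * ρ b = ρ x
    rw [← map_mul]
    congr 1
    refine Subtype.ext (Prod.ext (LinearMap.ext fun z => ?_) rfl)
    change x.1.1 (s (d.rangeRestrict z)) = x.1.1 z
    have hz : s (d.rangeRestrict z) - z ∈ LinearMap.ker d := by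
      rw [LinearMap.mem_ker, map_sub, hs', sub_eq_zero]
      rfl
    rw [← sub_eq_zero, ← map_sub]
    exact congr_arg Subtype.val (LinearMap.congr_fun hx₀ ⟨_, hz⟩)

end ChainEnd

section KProjective

variable {C : Type u} [Category.{v} C] [Abelian C] [HasDerivedCategory.{w} C]
  {K : CochainComplex C ℤ} [K.IsKProjective]

theorem Q_map_surjective (L : CochainComplex C ℤ) (f : DerivedCategory.Q.obj K ⟶ DerivedCategory.Q.obj L) :
    ∃ g : K ⟶ L, DerivedCategory.Q.map g = f := by
  obtain ⟨g, hg⟩ := (CochainComplex.IsKProjective.Qh_map_bijective K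
    ((HomotopyCategory.quotient _ _).obj L)).surjective f
  obtain ⟨g, rfl⟩ := (HomotopyCategory.quotient _ _).map_surjective g
  exact ⟨g, hg⟩

theorem Q_map_eq_zero_iff {L : CochainComplex C ℤ} (f : K ⟶ L) :
    DerivedCategory.Q.map f = 0 ↔ Nonempty (Homotopy f 0) := by
  refine ⟨fun h => ?_, fun ⟨h⟩ => ?_⟩
  · refine ⟨HomotopyCategory.homotopyOfEq _ _ ((CochainComplex.IsKProjective.Qh_map_bijective K
      ((HomotopyCategory.quotient _ _).obj L)).injective ?_)⟩
    refine h.trans ?_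
    rw [Functor.map_zero, Functor.map_zero]
    rfl
  · change DerivedCategory.Qh.map ((HomotopyCategory.quotient _ _).map f) = 0
    rw [HomotopyCategory.eq_of_homotopy f 0 h, Functor.map_zero, Functor.map_zero]

theorem eq_zero_of_homotopy {L : CochainComplex C ℤ} (h : ∀ g : K ⟶ L, Nonempty (Homotopy g 0))
    (f : DerivedCategory.Q.obj K ⟶ DerivedCategory.Q.obj L) : f = 0 := by
  obtain ⟨g, rfl⟩ := Q_map_surjective L f
  exact (Q_map_eq_zero_iff g).2 (h g)

end KProjective

section TwoTerm

variable {S : Type} [Ring S] {P : CochainComplex (ModuleCat.{0} S) ℤ}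

theorem IsTwoTermCplx.isKProjective (hP : IsTwoTermCplx S P) : P.IsKProjective := by
  have := hP.1
  have : P.IsStrictlyLE 0 := by
    rw [CochainComplex.isStrictlyLE_iff]
    exact fun i hi => hP.2.2 i (by omega) (by omega)
  exact CochainComplex.isKProjective_of_projective P 0

theorem IsTwoTermCplx.hom_ext (hP : IsTwoTermCplx S P) {K : CochainComplex (ModuleCat.{0} S) ℤ}
    {f g : P ⟶ K} (h₁ : f.f (-1) = g.f (-1)) (h₀ : f.f 0 = g.f 0) : f = g := by
  ext1 i
  by_cases hi₁ : i = -1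
  · subst hi₁; exact h₁
  by_cases hi₀ : i = 0
  · subst hi₀; exact h₀
  exact (hP.2.2 i hi₁ hi₀).eq_of_src _ _

/-- A chain map out of a two-term complex. -/
def IsTwoTermCplx.mkHom (hP : IsTwoTermCplx S P) {K : CochainComplex (ModuleCat.{0} S) ℤ}
    (a : P.X (-1) ⟶ K.X (-1)) (b : P.X 0 ⟶ K.X 0) (hab : a ≫ K.d (-1) 0 = P.d (-1) 0 ≫ b)
    (hb : b ≫ K.d 0 1 = 0) : P ⟶ K where
  f
    | Int.negSucc 0 => a
    | Int.ofNat 0 => b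
    | _ => 0
  comm' := by
    rintro i j (rfl : i + 1 = j)
    by_cases hi₁ : i = -1
    · subst hi₁
      exact hab
    by_cases hi₀ : i = 0
    · subst hi₀
      refine hb.trans ?_
      symm
      exact comp_zero
    exact (hP.2.2 i hi₁ hi₀).eq_of_src _ _

/-- A null-homotopy of a chain map out of a two-term complex. -/
theorem IsTwoTermCplx.nonempty_homotopy (hP : IsTwoTermCplx S P)
    {K : CochainComplex (ModuleCat.{0} S) ℤ} (f : P ⟶ K) (h₀ : P.X 0 ⟶ K.X (-1))
    (h₁ : P.X (-1) ⟶ K.X (-2))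
    (hf₁ : f.f (-1) = P.d (-1) 0 ≫ h₀ + h₁ ≫ K.d (-2) (-1)) (hf₀ : f.f 0 = h₀ ≫ K.d (-1) 0) :
    Nonempty (Homotopy f 0) := by
  let h : ∀ i j, P.X i ⟶ K.X j := fun
    | Int.ofNat 0, Int.negSucc 0 => h₀
    | Int.negSucc 0, Int.negSucc 1 => h₁
    | _, _ => 0
  refine ⟨{ hom := h, zero := fun i j hij => ?_, comm := fun i => ?_ }⟩
  · match i, j with
    | Int.ofNat 0, Int.negSucc 0 => exact (hij rfl).elim
    | Int.negSucc 0, Int.negSucc 1 => exact (hij rfl).elim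
    | Int.ofNat (n + 1), _ => rfl
    | Int.negSucc (n + 1), _ => rfl
    | Int.ofNat 0, Int.ofNat n => rfl
    | Int.ofNat 0, Int.negSucc (n + 1) => rfl
    | Int.negSucc 0, Int.ofNat n => rfl
    | Int.negSucc 0, Int.negSucc 0 => rfl
    | Int.negSucc 0, Int.negSucc (n + 2) => rfl
  · rw [dNext_eq (i' := i + 1) h rfl, prevD_eq (j' := i - 1) h (sub_add_cancel i 1)]
    by_cases hi₁ : i = -1
    · subst hi₁
      refine hf₁.trans ?_
      rw [HomologicalComplex.zero_f, add_zero]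
      rfl
    by_cases hi₀ : i = 0
    · subst hi₀
      refine hf₀.trans ?_
      rw [(hP.2.2 (0 + 1) (by simp) (by simp)).eq_of_tgt (P.d 0 (0 + 1)) 0, zero_comp, zero_add,
        HomologicalComplex.zero_f, add_zero]
      rfl
    exact (hP.2.2 i hi₁ hi₀).eq_of_src _ _

theorem homotopy_zero_apply {K : CochainComplex (ModuleCat.{0} S) ℤ} {f : P ⟶ K}
    (h : Homotopy f 0) : f.f (-1) = P.d (-1) 0 ≫ h.hom 0 (-1) + h.hom (-1) (-2) ≫ K.d (-2) (-1) := by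
  rw [h.comm, dNext_eq (i := -1) (i' := 0) h.hom (by simp), prevD_eq (j := -1) (j' := -2) h.hom (by simp),
    HomologicalComplex.zero_f, add_zero]

theorem IsTwoTermCplx.homotopy_zero_apply_zero (hP : IsTwoTermCplx S P)
    {K : CochainComplex (ModuleCat.{0} S) ℤ} {f : P ⟶ K}
    (h : Homotopy f 0) : f.f 0 = h.hom 0 (-1) ≫ K.d (-1) 0 := by
  rw [h.comm, dNext_eq (i := 0) (i' := 1) h.hom rfl, prevD_eq (j := 0) (j' := -1) h.hom (by simp),
    HomologicalComplex.zero_f, add_zero, (hP.2.2 1 (by simp) (by simp)).eq_of_tgt (P.d 0 1) 0,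
    zero_comp, zero_add]

/-- The chain endomorphisms of a two-term complex, as pairs of linear maps. -/
def IsTwoTermCplx.endEquiv (hP : IsTwoTermCplx S P) : End P ≃+* chainEnd (P.d (-1) 0).hom where
  toFun f := ⟨((f.f (-1)).hom, (f.f 0).hom), congr_arg ModuleCat.Hom.hom (f.comm (-1) 0)⟩
  invFun x := hP.mkHom (ModuleCat.ofHom x.1.1) (ModuleCat.ofHom x.1.2)
    (ModuleCat.hom_ext x.2) ((hP.2.2 1 (by simp) (by simp)).eq_of_tgt _ _)
  left_inv f := hP.hom_ext rfl rfl
  right_inv x := rfl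
  map_mul' _ _ := rfl
  map_add' _ _ := rfl

variable [HasDerivedCategory.{w} (ModuleCat.{0} S)]

/-- The action of chain endomorphisms on the object of the derived category. -/
def IsTwoTermCplx.toEnd (hP : IsTwoTermCplx S P) :
    chainEnd (P.d (-1) 0).hom →+* End (DerivedCategory.Q.obj P) :=
  RingHom.comp
    { DerivedCategory.Q.mapEnd P with
      map_zero' := DerivedCategory.Q.map_zero _ _
      map_add' := fun _ _ => DerivedCategory.Q.map_add }
    (hP.endEquiv.symm : chainEnd (P.d (-1) 0).hom →+* End P)

theorem IsTwoTermCplx.toEnd_surjective (hP : IsTwoTermCplx S P) :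
    Function.Surjective hP.toEnd := by
  have := hP.isKProjective
  intro f
  obtain ⟨g, hg⟩ := Q_map_surjective P f
  refine ⟨hP.endEquiv g, ?_⟩
  change DerivedCategory.Q.map (hP.endEquiv.symm (hP.endEquiv g)) = f
  rw [RingEquiv.symm_apply_apply, hg]

theorem IsTwoTermCplx.toEnd_eq_zero_iff (hP : IsTwoTermCplx S P) (x : chainEnd (P.d (-1) 0).hom) :
    hP.toEnd x = 0 ↔ ∃ h : P.X 0 →ₗ[S] P.X (-1),
      x.1.1 = h ∘ₗ (P.d (-1) 0).hom ∧ x.1.2 = (P.d (-1) 0).hom ∘ₗ h := by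
  have := hP.isKProjective
  refine (Q_map_eq_zero_iff (hP.endEquiv.symm x)).trans ⟨fun ⟨h⟩ => ⟨(h.hom 0 (-1)).hom, ?_, ?_⟩,
    fun ⟨h, h₁, h₀⟩ => ?_⟩
  · have h₁ := homotopy_zero_apply h
    rw [(hP.2.2 (-2) (by simp) (by simp)).eq_of_src (P.d (-2) (-1)) 0, comp_zero, add_zero] at h₁
    exact congr_arg ModuleCat.Hom.hom h₁
  · exact congr_arg ModuleCat.Hom.hom (hP.homotopy_zero_apply_zero h)
  · refine hP.nonempty_homotopy _ (ModuleCat.ofHom h) 0 ?_ (ModuleCat.hom_ext h₀)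
    rw [zero_comp, add_zero]
    exact ModuleCat.hom_ext h₁

theorem IsTwoTermCplx.isTors_coker (hP : IsTwoTermCplx S P)
    (h : ∀ f : DerivedCategory.Q.obj P ⟶ (DerivedCategory.Q.obj P)⟦(1 : ℤ)⟧, f = 0) :
    IsTors (P.d (-1) 0).hom (P.X 0 ⧸ LinearMap.range (P.d (-1) 0).hom) := by
  have := hP.isKProjective
  have := hP.1
  have : Module.Projective S (P.X (-1)) := (IsProjective.iff_projective _).2 (hP.1 (-1))
  intro g
  obtain ⟨g, rfl⟩ := Module.projective_lifting_property (LinearMap.range (P.d (-1) 0).hom).mkQ g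
    (Submodule.mkQ_surjective _)
  have hz₀ : IsZero ((P⟦(1 : ℤ)⟧).X 0) := hP.2.2 (0 + 1) (by simp) (by simp)
  let φ : P ⟶ P⟦(1 : ℤ)⟧ := hP.mkHom (K := P⟦(1 : ℤ)⟧) (ModuleCat.ofHom g) 0
    (hz₀.eq_of_tgt _ _) zero_comp
  have hφ : DerivedCategory.Q.map φ = 0 := by
    rw [← cancel_mono ((DerivedCategory.Q.commShiftIso (1 : ℤ)).hom.app P), zero_comp]
    exact h _
  obtain ⟨H⟩ := (Q_map_eq_zero_iff φ).1 hφ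
  let h₀ : P.X 0 ⟶ P.X 0 := show P.X 0 ⟶ P.X (-1 + 1) from H.hom 0 (-1)
  let h₁ : P.X (-1) ⟶ P.X (-1) := show P.X (-1) ⟶ P.X (-2 + 1) from H.hom (-1) (-2)
  refine ⟨(LinearMap.range (P.d (-1) 0).hom).mkQ ∘ₗ h₀.hom, ?_⟩
  ext y
  have hd : (P⟦(1 : ℤ)⟧).d (-2) (-1) = -P.d (-2 + 1) (-1 + 1) := by
    rw [CochainComplex.shiftFunctor_obj_d', Int.negOnePow_one, Units.neg_smul, one_smul]
  have hH := homotopy_zero_apply H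
  rw [hd] at hH
  have hH' : ModuleCat.ofHom g = P.d (-1) 0 ≫ h₀ + h₁ ≫ (-P.d (-1) 0) := hH
  have hy : g y = h₀.hom ((P.d (-1) 0).hom y) - (P.d (-1) 0).hom (h₁.hom y) := by
    rw [Preadditive.comp_neg, ← sub_eq_add_neg] at hH'
    exact congr_arg (fun l : P.X (-1) ⟶ P.X 0 => l.hom y) hH'
  refine (Submodule.Quotient.eq _).2 ?_
  rw [hy, sub_sub_cancel]
  exact ⟨_, rfl⟩

end TwoTerm

section Separation

variable {S : Type} [Ring S] {P : CochainComplex (ModuleCat.{0} S) ℤ}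

theorem IsTwoTermCplx.nonempty_homotopy_of_single (hP : IsTwoTermCplx S P)
    (X : ModuleCat.{0} S) (hX : IsTors (P.d (-1) 0).hom X)
    (hX₀ : ∀ u : (P.X 0 ⧸ LinearMap.range (P.d (-1) 0).hom) →ₗ[S] X, u = 0) (m : ℤ)
    (f : P ⟶ (HomologicalComplex.single _ (ComplexShape.up ℤ) m).obj X) :
    Nonempty (Homotopy f 0) := by
  let K := (HomologicalComplex.single _ (ComplexShape.up ℤ) m).obj X
  have hK : ∀ i, i ≠ m → IsZero (K.X i) := fun i hi =>
    HomologicalComplex.isZero_single_obj_X _ _ _ _ hi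
  let e : K.X m ≅ X := HomologicalComplex.singleObjXSelf _ m X
  have hd : ∀ i j, K.d i j = 0 := fun i j => HomologicalComplex.single_obj_d _ _ _ _ _
  by_cases hm₁ : m = -1
  · subst hm₁
    obtain ⟨h, hh⟩ := hX (f.f (-1) ≫ e.hom).hom
    refine hP.nonempty_homotopy f (ModuleCat.ofHom h ≫ e.inv) 0 ?_
      ((hK 0 (by simp)).eq_of_tgt _ _)
    rw [zero_comp, add_zero, ← cancel_mono e.hom]
    simp only [Category.assoc, Iso.inv_hom_id, Category.comp_id]
    exact (ModuleCat.hom_ext hh).symm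
  · have h₁ : f.f (-1) = 0 := (hK (-1) (Ne.symm hm₁)).eq_of_tgt _ _
    have h₀ : f.f 0 = 0 := by
      by_cases hm₀ : m = 0
      · subst hm₀
        have hc : (f.f 0 ≫ e.hom).hom ∘ₗ (P.d (-1) 0).hom = 0 := by
          have := f.comm (-1) 0
          rw [hd, comp_zero] at this
          refine congr_arg ModuleCat.Hom.hom (a₁ := P.d (-1) 0 ≫ f.f 0 ≫ e.hom) (a₂ := 0) ?_
          rw [← Category.assoc, ← this, zero_comp]
        obtain ⟨u, hu⟩ := exists_comp_mkQ_eq _ hc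
        rw [hX₀ u, LinearMap.zero_comp] at hu
        rw [← cancel_mono e.hom, zero_comp]
        exact ModuleCat.hom_ext hu.symm
      · exact (hK 0 (Ne.symm hm₀)).eq_of_tgt _ _
    have hf : f = 0 := hP.hom_ext h₁ h₀
    exact ⟨Homotopy.ofEq hf⟩

theorem isPerfCplx_single_self :
    IsPerfCplx S ((HomologicalComplex.single _ (ComplexShape.up ℤ) 0).obj (ModuleCat.of S S)) := by
  have hz : ∀ i : ℤ, i ≠ 0 → IsZero (((HomologicalComplex.single _ (ComplexShape.up ℤ) 0).obj
      (ModuleCat.of S S)).X i) := fun i hi => HomologicalComplex.isZero_single_obj_X _ _ _ _ hi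
  let e := HomologicalComplex.singleObjXSelf (ComplexShape.up ℤ) 0 (ModuleCat.of S S)
  refine ⟨fun i => ?_, fun i => ?_, 0, 0, fun i hi => hz i (by omega)⟩
  · by_cases hi : i = 0
    · subst hi
      exact Projective.of_iso e.symm inferInstance
    · exact Projective.of_iso (hz i hi).isoZero.symm inferInstance
  · by_cases hi : i = 0
    · subst hi
      exact Module.Finite.equiv e.symm.toLinearEquiv
    · have := ModuleCat.subsingleton_of_isZero (hz i hi)
      infer_instance

theorem IsTwoTermCplx.hasPD_coker (hP : IsTwoTermCplx S P) (n : ℕ)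
    (h : HasProjectiveDimensionLE (P.homology 0) n) :
    HasPD S (P.X 0 ⧸ LinearMap.range (P.d (-1) 0).hom) n :=
  have : HasProjectiveDimensionLT (P.homology 0) (n + 1) := h
  hasProjectiveDimensionLT_of_iso
    (P.isoHomologyι 0 1 (by simp) ((hP.2.2 1 (by simp) (by simp)).eq_of_tgt _ _) ≪≫
      (P.opcyclesIsCokernel (-1) 0 (by simp)).coconePointUniqueUpToIso
        (ModuleCat.cokernelIsColimit (P.d (-1) 0))) (n + 1)

variable [HasDerivedCategory.{w} (ModuleCat.{0} S)]

theorem isThick_setOf_hom_single_eq_zero (X : ModuleCat.{0} S) :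
    IsThick {Z : DerivedCategory (ModuleCat.{0} S) |
      ∀ (m : ℤ) (f : Z ⟶ (DerivedCategory.singleFunctor (ModuleCat.{0} S) m).obj X), f = 0} := by
  refine ⟨fun Z Z' e hZ m f => ?_, fun Z n hZ m f => ?_, fun T hT h₁ h₃ m f => ?_,
    fun Z Z' ι r hr hZ m f => ?_⟩
  · rw [← cancel_epi e.hom, hZ m (e.hom ≫ f), comp_zero]
  · let e := ((DerivedCategory.singleFunctors (ModuleCat.{0} S)).shiftIso n m (n + m) rfl).app X
    obtain ⟨g, hg⟩ := (shiftFunctor (DerivedCategory (ModuleCat.{0} S)) n).map_surjective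
      (f ≫ e.inv)
    rw [hZ _ g, Functor.map_zero] at hg
    rw [← cancel_mono e.inv, ← hg, zero_comp]
  · obtain ⟨g, rfl⟩ := Triangle.yoneda_exact₂ T hT f (h₁ m _)
    rw [h₃ m g, comp_zero]
  · rw [← Category.id_comp f, ← hr, Category.assoc, hZ m (r ≫ f), comp_zero]

theorem IsTwoTermSilting.separates (hP : IsTwoTermSilting S P) :
    Separates (P.d (-1) 0).hom := by
  intro X _ _ hX hX₀
  have := hP.1.isKProjective
  have h := hP.2.2 _ (isThick_setOf_hom_single_eq_zero (ModuleCat.of S X))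
    (fun m => eq_zero_of_homotopy
      (hP.1.nonempty_homotopy_of_single (ModuleCat.of S X) hX hX₀ m)) _ isPerfCplx_single_self 0
  have h' : ∀ g : S →ₗ[S] X, g = 0 := fun g => by
    have hg : (DerivedCategory.singleFunctor (ModuleCat.{0} S) 0).map (ModuleCat.ofHom g) = 0 :=
      h ((DerivedCategory.singleFunctor (ModuleCat.{0} S) 0).map (ModuleCat.ofHom g))
    have hg₀ : ModuleCat.ofHom g = 0 :=
      (DerivedCategory.singleFunctor (ModuleCat.{0} S) 0).map_injective
        (hg.trans (Functor.map_zero _ (ModuleCat.of S S) (ModuleCat.of S X)).symm)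
    exact congr_arg ModuleCat.Hom.hom hg₀
  refine subsingleton_of_forall_eq 0 fun x => ?_
  simpa using LinearMap.congr_fun (h' (LinearMap.toSpanSingleton S X x)) 1

end Separation

/-- If `A` is a finite dimensional `k`-algebra of finite global dimension
(`gl.dim A ≤ d`) and `P` is a 2-term silting complex in `K^b(proj A)` whose zeroth
cohomology module `H^0(P)` has projective dimension at most `1`, then
`B = End_{D^b(A)}(P)` has global dimension at most `2 * gl.dim A + 2`. -/
theorem gldim_end_le_of_pd_H0_le_one
    (k A : Type) [Field k] [Ring A] [Algebra k A] [FiniteDimensional k A]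
    [HasDerivedCategory.{w} (ModuleCat.{0} Aᵐᵒᵖ)]
    (P : CochainComplex (ModuleCat.{0} Aᵐᵒᵖ) ℤ)
    (hP : IsTwoTermSilting Aᵐᵒᵖ P)
    (d : ℕ) (hgld : gldLE.{0, 0} Aᵐᵒᵖ d)
    (hH0 : pdLE.{0, 0} Aᵐᵒᵖ 1 (P.homology 0)) :
    gldLE.{w, w} (End (DerivedCategory.Q.obj P))ᵐᵒᵖ (2 * d + 2) := by
  intro M hM
  refine pdLE_of_hasProjectiveDimensionLE _ M ?_
  have : Module.Finite Aᵐᵒᵖ (P.X (-1)) := hP.1.2.1 (-1)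
  have : Module.Finite Aᵐᵒᵖ (P.X 0) := hP.1.2.1 0
  have : Module.Projective Aᵐᵒᵖ (P.X (-1)) := (IsProjective.iff_projective _).2 (hP.1.1 (-1))
  have : Module.Projective Aᵐᵒᵖ (P.X 0) := (IsProjective.iff_projective _).2 (hP.1.1 0)
  rw [show 2 * d + 2 = d + (d + 1 + 1) by ring]
  exact hasPD_of_chainEnd_quotient k (hP.1.isTors_coker hP.2.1) hP.separates
    (hP.1.hasPD_coker 1 (hasProjectiveDimensionLE_of_pdLE 1 _ hH0)) d
    (fun X _ _ _ => hasProjectiveDimensionLE_of_pdLE d _ (hgld (ModuleCat.of Aᵐᵒᵖ X) ‹_›))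
    hP.1.toEnd hP.1.toEnd_surjective hP.1.toEnd_eq_zero_iff M

end

end TwoTermSilting
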